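/- arXiv:0904.1295 — 3 statements merged into one kernel-verified Lean document; each statement's English description precedes it below -/
import Mathlib

section
/- If f is a transcendental entire function in the Eremenko–Lyubich class B, then the order of f satisfies ρ(f) = limsup_{r→∞} (log log M(r,f))/(log r) ≥ 1/2; more precisely, log log M(r,f) ≥ (1/2) log r − O(1) as r → ∞. -/
open MeasureTheory Filter Topology

/-- The maximum modulus `M(r,f) = max_{|z|=r} |f(z)|`. -/
noncomputable def maxModulus (f : ℂ → ℂ) (r : ℝ) : ℝ :=
  sSup ((fun z => ‖f z‖) '' Metric.sphere (0 : ℂ) r)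

/-- An entire function is transcendental if it is not a polynomial. -/
def TranscendentalEntire (f : ℂ → ℂ) : Prop :=
  Differentiable ℂ f ∧ ¬ ∃ p : Polynomial ℂ, ∀ z, f z = p.eval z

/-- The set of critical values of `f`. -/
def criticalValues (f : ℂ → ℂ) : Set ℂ :=
  {w | ∃ z, deriv f z = 0 ∧ f z = w}

/-- The set of finite asymptotic values of `f`. -/
def asymptoticValues (f : ℂ → ℂ) : Set ℂ :=
  {a | ∃ γ : ℝ → ℂ, Continuous γ ∧
    Tendsto (fun t => ‖γ t‖) atTop atTop ∧
    Tendsto (fun t => f (γ t)) atTop (nhds a)}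

/-- The Eremenko–Lyubich class `B`. -/
def InClassB (f : ℂ → ℂ) : Prop :=
  TranscendentalEntire f ∧
  Bornology.IsBounded (criticalValues f ∪ asymptoticValues f)

/-- Polar coordinates on an annulus centred at the origin. -/
theorem lintegral_annulus_eq {F : ℂ → ℝ} {ε ρ : ℝ} (hε : 0 ≤ ε)
    (hF : ContinuousOn F {z | ε < ‖z‖ ∧ ‖z‖ < ρ}) :
    ∫⁻ z in {z : ℂ | ε < ‖z‖ ∧ ‖z‖ < ρ}, ENNReal.ofReal (F z) =
      ∫⁻ r in Set.Ioo ε ρ, ∫⁻ θ in Set.Ioo (-Real.pi) Real.pi,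
        ENNReal.ofReal (r * F (circleMap 0 r θ)) := by
  have hA : IsOpen {z : ℂ | ε < ‖z‖ ∧ ‖z‖ < ρ} :=
    (isOpen_lt continuous_const continuous_norm).inter (isOpen_lt continuous_norm continuous_const)
  have hS : IsOpen (Set.Ioo ε ρ ×ˢ Set.Ioo (-Real.pi) Real.pi) := isOpen_Ioo.prod isOpen_Ioo
  have hmap : ∀ p : ℝ × ℝ, Complex.polarCoord.symm p = circleMap 0 p.1 p.2 := by
    intro p
    rw [Complex.polarCoord_symm_apply, circleMap, zero_add, Complex.exp_mul_I]
    push_cast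
    ring
  rw [← lintegral_indicator hA.measurableSet, ← Complex.lintegral_comp_polarCoord_symm]
  have hcont : ContinuousOn (fun p : ℝ × ℝ => p.1 * F (circleMap 0 p.1 p.2))
      (Set.Ioo ε ρ ×ˢ Set.Ioo (-Real.pi) Real.pi) := by
    refine continuousOn_fst.mul (hF.comp ?_ ?_)
    · simp only [circleMap]; fun_prop
    · rintro ⟨r, θ⟩ ⟨⟨h1, h2⟩, -⟩
      simp only [Set.mem_ofPred_eq, norm_circleMap_zero]
      rw [abs_of_pos (by simpa using lt_of_le_of_lt hε h1)]
      exact ⟨h1, h2⟩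
  have hae := hcont.aemeasurable (μ := volume) hS.measurableSet
  rw [Measure.volume_eq_prod, ← Measure.prod_restrict] at hae
  rw [← lintegral_prod (fun p : ℝ × ℝ => ENNReal.ofReal (p.1 * F (circleMap 0 p.1 p.2)))
    hae.ennreal_ofReal, Measure.prod_restrict, ← Measure.volume_eq_prod]
  rw [← lintegral_indicator hS.measurableSet,
    ← lintegral_indicator (by exact polarCoord.open_target.measurableSet)]
  refine lintegral_congr fun p => ?_
  simp only [hmap]
  by_cases hp : p ∈ polarCoord.target
  · have h0 : 0 < p.1 := hp.1
    rw [Set.indicator_of_mem hp]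
    by_cases hq : ε < p.1 ∧ p.1 < ρ
    · rw [Set.indicator_of_mem (show p ∈ Set.Ioo ε ρ ×ˢ _ from ⟨hq, hp.2⟩), Set.indicator_of_mem,
        smul_eq_mul, ENNReal.ofReal_mul h0.le]
      simpa [abs_of_pos h0] using hq
    · rw [Set.indicator_of_notMem (s := {z : ℂ | ε < ‖z‖ ∧ ‖z‖ < ρ}), Set.indicator_of_notMem,
        smul_zero]
      · exact fun h => hq h.1
      · simpa [abs_of_pos h0] using hq
  · rw [Set.indicator_of_notMem hp, Set.indicator_of_notMem]
    exact fun h => hp ⟨lt_of_le_of_lt hε h.1.1, h.2⟩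

/-- Change of variables for the logarithmic area `|w|⁻² dA` under an injective holomorphic map. -/
theorem lintegral_image_norm_inv_sq {A : Set ℂ} (hA : IsOpen A) {G : ℂ → ℂ}
    (hG : DifferentiableOn ℂ G A) (hinj : Set.InjOn G A) :
    ∫⁻ w in G '' A, ENNReal.ofReal ((‖w‖ ^ 2)⁻¹) =
      ∫⁻ z in A, ENNReal.ofReal (‖deriv G z / G z‖ ^ 2) := by
  rw [lintegral_image_eq_lintegral_abs_det_fderiv_mul volume hA.measurableSet
    (f' := fun z => ((ContinuousLinearMap.toSpanSingleton ℂ (deriv G z)).restrictScalars ℝ))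
    (fun z hz => ((hG.differentiableAt (hA.mem_nhds hz)).hasDerivAt.hasFDerivAt.restrictScalars
      ℝ).hasFDerivWithinAt) hinj]
  refine setLIntegral_congr_fun hA.measurableSet fun z hz => ?_
  have hdet : ((ContinuousLinearMap.toSpanSingleton ℂ (deriv G z)).restrictScalars ℝ).det
      = ‖deriv G z‖ ^ 2 := by
    rw [← Complex.normSq_eq_norm_sq, ← Algebra.norm_complex_apply, Algebra.norm_apply,
      ContinuousLinearMap.det]
    congr 1
    ext; simp [mul_comm]
  rw [hdet, ← ENNReal.ofReal_mul (abs_nonneg _), abs_of_nonneg (by positivity), norm_div, div_pow,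
    div_eq_mul_inv]

theorem lintegral_annulus_norm_inv_sq {ε ρ : ℝ} (hε : 0 < ε) (hρ : ε ≤ ρ) :
    ∫⁻ z in {z : ℂ | ε < ‖z‖ ∧ ‖z‖ < ρ}, ENNReal.ofReal ((‖z‖ ^ 2)⁻¹) =
      ENNReal.ofReal (2 * Real.pi * Real.log (ρ / ε)) := by
  rw [lintegral_annulus_eq (F := fun z => (‖z‖ ^ 2)⁻¹) hε.le]
  · have : ∀ r ∈ Set.Ioo ε ρ, ∫⁻ θ in Set.Ioo (-Real.pi) Real.pi,
        ENNReal.ofReal (r * (‖circleMap 0 r θ‖ ^ 2)⁻¹) = ENNReal.ofReal (2 * Real.pi * r⁻¹) := by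
      intro r hr
      have h0 : 0 < r := hε.trans hr.1
      have : r * (r ^ 2)⁻¹ = r⁻¹ := by field_simp
      simp only [norm_circleMap_zero, sq_abs, this, lintegral_const, Measure.restrict_apply,
        MeasurableSet.univ, Set.univ_inter, Real.volume_Ioo]
      rw [← ENNReal.ofReal_mul (by positivity)]
      congr 1; ring
    rw [setLIntegral_congr_fun measurableSet_Ioo this, ← ofReal_integral_eq_lintegral_ofReal]
    · rw [← integral_Ioc_eq_integral_Ioo, ← intervalIntegral.integral_of_le hρ,
        intervalIntegral.integral_const_mul, integral_inv_of_pos hε (hε.trans_le hρ)]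
    · have : IntervalIntegrable (fun r : ℝ => 2 * Real.pi * r⁻¹) volume ε ρ := by
        apply ContinuousOn.intervalIntegrable
        rw [Set.uIcc_of_le hρ]
        exact continuousOn_const.mul (continuousOn_inv₀.mono fun x hx => (hε.trans_le hx.1).ne')
      rw [intervalIntegrable_iff_integrableOn_Ioo_of_le hρ] at this
      exact this
    · filter_upwards [ae_restrict_mem measurableSet_Ioo] with r hr
      have h0 : 0 < r := hε.trans hr.1
      have := Real.pi_pos
      simp only [Pi.zero_apply]; positivity
  · intro z hz
    have : ‖z‖ ^ 2 ≠ 0 := pow_ne_zero _ (hε.trans hz.1).ne'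
    exact ((continuous_norm.pow 2).continuousAt.inv₀ this).continuousWithinAt

theorem two_pi_le_lintegral_circle_norm_sq {h : ℂ → ℂ}
    (hh : DifferentiableOn ℂ h (Metric.ball 0 1)) (h0 : h 0 = 1) {r : ℝ} (hr0 : 0 < r)
    (hr1 : r < 1) :
    ENNReal.ofReal (2 * Real.pi) ≤
      ∫⁻ θ in Set.Ioo (-Real.pi) Real.pi, ENNReal.ofReal (‖h (circleMap 0 r θ)‖ ^ 2) := by
  have hπ := Real.pi_pos
  have hc : Continuous fun θ : ℝ => h (circleMap 0 r θ) :=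
    hh.continuousOn.comp_continuous (continuous_circleMap 0 r) fun θ => by
      simpa [abs_of_pos hr0] using hr1
  have hmean : ∫ θ in (-Real.pi)..Real.pi, h (circleMap 0 r θ) = 2 * Real.pi := by
    have hper : Function.Periodic (fun θ : ℝ => h (circleMap 0 r θ)) (2 * Real.pi) :=
      fun θ => by simp only [periodic_circleMap 0 r θ]
    have h1 := hper.intervalIntegral_add_eq (-Real.pi) 0
    have h2 : Real.circleAverage h 0 r = h 0 := by
      refine DiffContOnCl.circleAverage (DifferentiableOn.diffContOnCl (hh.mono ?_))
      rw [abs_of_pos hr0, closure_ball _ hr0.ne']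
      exact Metric.closedBall_subset_ball hr1
    rw [Real.circleAverage_def, h0] at h2
    rw [show -Real.pi + 2 * Real.pi = Real.pi by ring, zero_add] at h1
    rw [h1, (inv_smul_eq_iff₀ (by positivity)).1 h2]
    simp
  have hre : ∫ θ in (-Real.pi)..Real.pi, (h (circleMap 0 r θ)).re = 2 * Real.pi := by
    have := Complex.reCLM.intervalIntegral_comp_comm (hc.intervalIntegrable (μ := volume)
      (-Real.pi) Real.pi)
    simp only [Complex.reCLM_apply] at this
    rw [this, hmean]
    simp
  have hsqint : IntervalIntegrable (fun θ : ℝ => ‖h (circleMap 0 r θ)‖ ^ 2) volume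
      (-Real.pi) Real.pi := (hc.norm.pow 2).intervalIntegrable _ _
  have hre_cont : Continuous fun θ : ℝ => (h (circleMap 0 r θ)).re :=
    Complex.continuous_re.comp hc
  have hle : 2 * Real.pi ≤ ∫ θ in (-Real.pi)..Real.pi, ‖h (circleMap 0 r θ)‖ ^ 2 := by
    calc 2 * Real.pi
        = ∫ θ in (-Real.pi)..Real.pi, (2 * (h (circleMap 0 r θ)).re - 1) := by
          rw [intervalIntegral.integral_sub, intervalIntegral.integral_const_mul, hre]
          · simp; ring
          · exact (continuous_const.mul hre_cont).intervalIntegrable _ _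
          · exact intervalIntegrable_const
      _ ≤ _ := by
          refine intervalIntegral.integral_mono (by linarith)
            (((continuous_const.mul hre_cont).sub continuous_const).intervalIntegrable _ _) hsqint
            fun θ => ?_
          have h1 := Complex.re_le_norm (h (circleMap 0 r θ))
          simp only
          nlinarith [sq_nonneg (‖h (circleMap 0 r θ)‖ - 1)]
  rw [← ofReal_integral_eq_lintegral_ofReal]
  · refine ENNReal.ofReal_le_ofReal ?_
    rwa [← integral_Ioc_eq_integral_Ioo, ← intervalIntegral.integral_of_le (by linarith)]
  · rwa [intervalIntegrable_iff_integrableOn_Ioo_of_le (by linarith)] at hsqint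
  · exact Eventually.of_forall fun θ => by simp only [Pi.zero_apply]; positivity

theorem log_le_lintegral_norm_logDeriv_sq {B : ℂ → ℂ}
    (hB : DifferentiableOn ℂ B (Metric.ball 0 1)) (hinj : Set.InjOn B (Metric.ball 0 1))
    (hB0 : B 0 = 0) (hB' : deriv B 0 ≠ 0) {ε : ℝ} (hε : 0 < ε) (hε1 : ε ≤ 1) :
    ENNReal.ofReal (2 * Real.pi * Real.log (1 / ε)) ≤
      ∫⁻ z in {z : ℂ | ε < ‖z‖ ∧ ‖z‖ < 1}, ENNReal.ofReal (‖deriv B z / B z‖ ^ 2) := by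
  have hmem0 : (0 : ℂ) ∈ Metric.ball (0 : ℂ) 1 := by simp
  have hBne : ∀ z ∈ Metric.ball (0 : ℂ) 1, z ≠ 0 → B z ≠ 0 := fun z hz hz0 h =>
    hz0 (hinj hz hmem0 (h.trans hB0.symm))
  have hd : DifferentiableOn ℂ (deriv B) (Metric.ball 0 1) := hB.deriv Metric.isOpen_ball
  have hk : DifferentiableOn ℂ (dslope B 0) (Metric.ball 0 1) :=
    (Complex.differentiableOn_dslope (Metric.isOpen_ball.mem_nhds hmem0)).2 hB
  have hslope : ∀ z, z ≠ 0 → dslope B 0 z = B z / z := fun z hz => by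
    rw [dslope_of_ne _ hz, slope_def_field, hB0, sub_zero, sub_zero]
  have hkne : ∀ z ∈ Metric.ball (0 : ℂ) 1, dslope B 0 z ≠ 0 := by
    intro z hz
    by_cases hz0 : z = 0
    · simpa [hz0] using hB'
    · rw [hslope z hz0]
      exact div_ne_zero (hBne z hz hz0) hz0
  have hh : DifferentiableOn ℂ (fun z => deriv B z / dslope B 0 z) (Metric.ball 0 1) :=
    hd.div hk hkne
  have hA : {z : ℂ | ε < ‖z‖ ∧ ‖z‖ < 1} ⊆ Metric.ball 0 1 := fun z hz => by simpa using hz.2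
  rw [← lintegral_annulus_norm_inv_sq hε hε1, lintegral_annulus_eq hε.le, lintegral_annulus_eq hε.le]
  · refine setLIntegral_mono' measurableSet_Ioo fun r hr => ?_
    have h0 : 0 < r := hε.trans hr.1
    have key := two_pi_le_lintegral_circle_norm_sq hh (by simp [hB']) h0 hr.2
    have e1 : ∀ θ : ℝ, r * ‖deriv B (circleMap 0 r θ) / B (circleMap 0 r θ)‖ ^ 2 =
        r⁻¹ * ‖deriv B (circleMap 0 r θ) / dslope B 0 (circleMap 0 r θ)‖ ^ 2 := by
      intro θ
      rw [hslope _ (circleMap_ne_center h0.ne')]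
      simp only [norm_div, norm_circleMap_zero, abs_of_pos h0]
      field_simp
    have e2 : r * (r ^ 2)⁻¹ = r⁻¹ := by field_simp
    simp only [e1, norm_circleMap_zero, sq_abs, e2, lintegral_const, Measure.restrict_apply,
      MeasurableSet.univ, Set.univ_inter, Real.volume_Ioo, sub_neg_eq_add]
    simp only [ENNReal.ofReal_mul (inv_nonneg.2 h0.le)]
    rw [lintegral_const_mul' _ _ ENNReal.ofReal_ne_top]
    gcongr
    rwa [← two_mul]
  · refine ((hd.continuousOn.mono hA).div (hB.continuousOn.mono hA) ?_).norm.pow 2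
    exact fun z hz => hBne z (hA hz) (norm_pos_iff.1 (hε.trans hz.1))
  · intro z hz
    have : ‖z‖ ^ 2 ≠ 0 := pow_ne_zero _ (hε.trans hz.1).ne'
    exact ((continuous_norm.pow 2).continuousAt.inv₀ this).continuousWithinAt

/-- If `q < |B'(0)|` and `B(0) = 0`, small closed discs of radius `m` are covered by the image of
the closed disc of radius `m / q`. -/
theorem exists_preimage_of_lt_norm_deriv {B : ℂ → ℂ} (hB : AnalyticAt ℂ B 0) (hB0 : B 0 = 0)
    {q : ℝ} (hq : 0 < q) (hqB : q < ‖deriv B 0‖) :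
    ∀ᶠ w in 𝓝 (0 : ℂ), ∃ z, ‖z‖ ≤ ‖w‖ / q ∧ B z = w := by
  have hs : HasStrictDerivAt B (deriv B 0) 0 := hB.hasStrictDerivAt
  have hne : deriv B 0 ≠ 0 := norm_pos_iff.1 (hq.trans hqB)
  have hj := (hs.to_localInverse hne).hasDerivAt
  have hright := (hs.hasStrictFDerivAt_equiv hne).eventually_right_inverse
  have hj0 : hs.localInverse B (deriv B 0) 0 hne (B 0) = 0 :=
    (hs.hasStrictFDerivAt_equiv hne).localInverse_apply_image
  rw [hB0] at hj hright hj0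
  have hpos : 0 < q⁻¹ - ‖deriv B 0‖⁻¹ := sub_pos.2 ((inv_lt_inv₀ (hq.trans hqB) hq).2 hqB)
  filter_upwards [hright, hj.isLittleO.bound hpos] with w h1 h2
  refine ⟨_, ?_, h1⟩
  change ‖hs.localInverse B (deriv B 0) 0 hne w‖ ≤ _
  rw [hj0] at h2
  simp only [sub_zero, smul_eq_mul] at h2
  have h3 := norm_sub_norm_le (hs.localInverse B (deriv B 0) 0 hne w) (w * (deriv B 0)⁻¹)
  rw [norm_mul, norm_inv] at h3
  rw [div_eq_mul_inv]
  nlinarith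

/-- The Bieberbach–Eilenberg inequality for univalent functions. -/
theorem norm_deriv_le_one_of_mul_ne_one {B : ℂ → ℂ}
    (hB : DifferentiableOn ℂ B (Metric.ball 0 1)) (hinj : Set.InjOn B (Metric.ball 0 1))
    (hB0 : B 0 = 0)
    (hmul : ∀ z ∈ Metric.ball (0 : ℂ) 1, ∀ w ∈ Metric.ball (0 : ℂ) 1, B z * B w ≠ 1) :
    ‖deriv B 0‖ ≤ 1 := by
  by_contra! hlt
  obtain ⟨q, hq1, hqB⟩ := exists_between hlt
  have hq : 0 < q := zero_lt_one.trans hq1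
  have hmem0 : (0 : ℂ) ∈ Metric.ball (0 : ℂ) 1 := by simp
  have hcov := exists_preimage_of_lt_norm_deriv
    (hB.analyticAt (Metric.isOpen_ball.mem_nhds hmem0)) hB0 hq hqB
  obtain ⟨δ, hδ, hcov⟩ := Metric.eventually_nhds_iff.1 hcov
  obtain ⟨m, hm, hmδ⟩ := exists_between (lt_min hδ one_pos)
  have hmδ' := hmδ.trans_le (min_le_left _ _)
  have hm1 := hmδ.trans_le (min_le_right _ _)
  have hε : 0 < m / q := div_pos hm hq
  have hε1 : m / q < 1 := (div_lt_one hq).2 (hm1.trans hq1)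
  have hcov' : ∀ w : ℂ, ‖w‖ ≤ m → ∃ z, ‖z‖ ≤ m / q ∧ B z = w := by
    intro w hw
    obtain ⟨z, hz, hzw⟩ := hcov (y := w) (by simpa using hw.trans_lt hmδ')
    exact ⟨z, hz.trans (by gcongr), hzw⟩
  set A : Set ℂ := {z : ℂ | m / q < ‖z‖ ∧ ‖z‖ < 1} with hAdef
  have hAo : IsOpen A :=
    (isOpen_lt continuous_const continuous_norm).inter (isOpen_lt continuous_norm continuous_const)
  have hA : A ⊆ Metric.ball 0 1 := fun z hz => by simpa using hz.2
  have hlow : ∀ z ∈ A, m < ‖B z‖ := by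
    intro z hz
    by_contra! h
    obtain ⟨z', hz', hzz⟩ := hcov' _ h
    have := hinj (by simpa using hz'.trans_lt hε1) (hA hz) hzz
    exact absurd hz' (by rw [this]; exact not_le.2 hz.1)
  have hne : ∀ z ∈ A, B z ≠ 0 := fun z hz => norm_pos_iff.1 (hm.trans (hlow z hz))
  have hhigh : ∀ z ∈ A, ‖B z‖ < 1 / m := by
    intro z hz
    by_contra! h
    have h' : ‖(B z)⁻¹‖ ≤ m := by
      rw [norm_inv]
      exact (inv_le_comm₀ (norm_pos_iff.2 (hne z hz)) hm).2 (by simpa using h)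
    obtain ⟨z', hz', hzz⟩ := hcov' _ h'
    refine hmul z (hA hz) z' (by simpa using hz'.trans_lt hε1) ?_
    rw [hzz, mul_inv_cancel₀ (hne z hz)]
  have hG : DifferentiableOn ℂ (fun z => (B z)⁻¹) A := (hB.mono hA).inv hne
  have hGinj : Set.InjOn (fun z => (B z)⁻¹) A := fun z hz w hw h =>
    hinj (hA hz) (hA hw) (inv_injective h)
  have hI := lintegral_image_norm_inv_sq hAo (hB.mono hA) (hinj.mono hA)
  have hI' := lintegral_image_norm_inv_sq hAo hG hGinj
  have hI'' : ∫⁻ z in A, ENNReal.ofReal (‖deriv (fun z => (B z)⁻¹) z / (B z)⁻¹‖ ^ 2) =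
      ∫⁻ z in A, ENNReal.ofReal (‖deriv B z / B z‖ ^ 2) := by
    refine setLIntegral_congr_fun hAo.measurableSet fun z hz => ?_
    have hd : HasDerivAt B (deriv B z) z :=
      (hB.differentiableAt (Metric.isOpen_ball.mem_nhds (hA hz))).hasDerivAt
    have := norm_pos_iff.2 (hne z hz)
    simp only [(hd.fun_inv (hne z hz)).deriv, norm_div, norm_neg, norm_pow, norm_inv]
    congr 2
    field_simp
  have hdisj : Disjoint (B '' A) ((fun z => (B z)⁻¹) '' A) := by
    rw [Set.disjoint_left]
    rintro _ ⟨z, hz, rfl⟩ ⟨w, hw, hwz⟩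
    refine hmul z (hA hz) w (hA hw) ?_
    rw [← show (B w)⁻¹ = B z from hwz, inv_mul_cancel₀ (hne w hw)]
  have hmeas : MeasurableSet ((fun z => (B z)⁻¹) '' A) :=
    hAo.measurableSet.image_of_continuousOn_injOn hG.continuousOn hGinj
  have hsub : B '' A ∪ (fun z => (B z)⁻¹) '' A ⊆ {w : ℂ | m < ‖w‖ ∧ ‖w‖ < 1 / m} := by
    rintro _ (⟨z, hz, rfl⟩ | ⟨z, hz, rfl⟩)
    · exact ⟨hlow z hz, hhigh z hz⟩
    · have hp := norm_pos_iff.2 (hne z hz)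
      refine ⟨?_, ?_⟩
      · rw [norm_inv]
        exact (lt_inv_comm₀ hm hp).2 (by simpa using hhigh z hz)
      · rw [norm_inv, ← one_div]
        exact one_div_lt_one_div_of_lt hm (hlow z hz)
  have hm1' : m ≤ 1 / m := by
    rw [le_div_iff₀ hm]; nlinarith
  have hup := lintegral_mono_set (μ := volume)
    (f := fun w : ℂ => ENNReal.ofReal ((‖w‖ ^ 2)⁻¹)) hsub
  rw [lintegral_union hmeas hdisj, hI, hI', hI'', lintegral_annulus_norm_inv_sq hm hm1'] at hup
  have hlo := log_le_lintegral_norm_logDeriv_sq hB hinj hB0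
    (norm_pos_iff.1 (hq.trans hqB)) hε hε1.le
  have hπ := Real.pi_pos
  have hfin := (add_le_add hlo hlo).trans hup
  have hlogpos : 0 ≤ Real.log (1 / (m / q)) :=
    Real.log_nonneg ((one_le_div hε).2 hε1.le)
  rw [← ENNReal.ofReal_add (by positivity) (by positivity), ENNReal.ofReal_le_ofReal_iff
    (mul_nonneg (by positivity) (Real.log_nonneg ((one_le_div hm).2 hm1')))] at hfin
  rw [one_div, Real.log_inv, Real.log_div hm.ne' hq.ne', one_div, Real.log_div (by positivity)
    hm.ne', Real.log_inv] at hfin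
  have hlq := Real.log_pos hq1
  nlinarith

/-- A nonvanishing holomorphic function on the unit disc has a holomorphic square root. -/
theorem exists_differentiableOn_sq_eq {φ : ℂ → ℂ} (hφ : DifferentiableOn ℂ φ (Metric.ball 0 1))
    (hne : ∀ z ∈ Metric.ball (0 : ℂ) 1, φ z ≠ 0) :
    ∃ s : ℂ → ℂ, DifferentiableOn ℂ s (Metric.ball 0 1) ∧
      ∀ z ∈ Metric.ball (0 : ℂ) 1, s z ^ 2 = φ z := by
  have hmem0 : (0 : ℂ) ∈ Metric.ball (0 : ℂ) 1 := by simp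
  obtain ⟨ℓ, hℓ0, hℓ⟩ := (((hφ.deriv Metric.isOpen_ball).div hφ hne).isExactOn_ball).with_val_at
    0 (Complex.log (φ 0))
  refine ⟨fun z => Complex.exp (ℓ z / 2), fun z hz =>
    ((hℓ z hz).div_const 2).cexp.differentiableAt.differentiableWithinAt, fun z hz => ?_⟩
  have hconst : ∀ z ∈ Metric.ball (0 : ℂ) 1,
      HasDerivAt (fun z => Complex.exp (-ℓ z) * φ z) 0 z := by
    intro z hz
    have h1 := (hℓ z hz).neg.cexp.mul
      (hφ.differentiableAt (Metric.isOpen_ball.mem_nhds hz)).hasDerivAt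
    refine h1.congr_deriv ?_
    have := hne z hz
    simp only [Pi.div_apply]
    field_simp
    ring
  have heq := (convex_ball (0 : ℂ) 1).is_const_of_fderivWithin_eq_zero (𝕜 := ℂ)
    (f := fun z => Complex.exp (-ℓ z) * φ z)
    (fun z hz => (hconst z hz).differentiableAt.differentiableWithinAt)
    (fun z hz => by
      rw [fderivWithin_of_isOpen Metric.isOpen_ball hz]
      ext
      simp [(hconst z hz).deriv]) hz hmem0
  simp only [hℓ0, Complex.exp_neg, Complex.exp_log (hne 0 hmem0)] at heq
  rw [inv_mul_cancel₀ (hne 0 hmem0), inv_mul_eq_one₀ (Complex.exp_ne_zero _)] at heq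
  rw [← Complex.exp_nat_mul, ← heq]
  congr 1
  push_cast
  ring

/-- Koebe's one-quarter theorem for a univalent function on the unit disc omitting `0`. -/
theorem norm_deriv_le_four_mul_norm {φ : ℂ → ℂ} (hφ : DifferentiableOn ℂ φ (Metric.ball 0 1))
    (hinj : Set.InjOn φ (Metric.ball 0 1)) (hne : ∀ z ∈ Metric.ball (0 : ℂ) 1, φ z ≠ 0) :
    ‖deriv φ 0‖ ≤ 4 * ‖φ 0‖ := by
  have hmem0 : (0 : ℂ) ∈ Metric.ball (0 : ℂ) 1 := by simp
  obtain ⟨s, hs, hsq⟩ := exists_differentiableOn_sq_eq hφ hne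
  have hsne : ∀ z ∈ Metric.ball (0 : ℂ) 1, s z ≠ 0 := fun z hz h =>
    hne z hz (by rw [← hsq z hz, h]; ring)
  have hadd : ∀ z ∈ Metric.ball (0 : ℂ) 1, ∀ w ∈ Metric.ball (0 : ℂ) 1, s z + s w ≠ 0 := by
    intro z hz w hw h
    have h1 : s z = -s w := eq_neg_of_add_eq_zero_left h
    have h2 : z = w := hinj hz hw (by rw [← hsq z hz, ← hsq w hw, h1]; ring)
    rw [h2, ← two_mul] at h
    exact hsne w hw (by simpa using h)
  set B : ℂ → ℂ := fun z => (s z - s 0) / (s z + s 0) with hBdef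
  have hB : DifferentiableOn ℂ B (Metric.ball 0 1) :=
    (hs.sub_const _).div (hs.add_const _) fun z hz => hadd z hz 0 hmem0
  have hs0 := hsne 0 hmem0
  have key := norm_deriv_le_one_of_mul_ne_one hB ?_ (by simp [hBdef]) ?_
  · have hds := (hs.differentiableAt (Metric.isOpen_ball.mem_nhds hmem0)).hasDerivAt
    have hdB := (hds.sub_const (s 0)).div (hds.add_const (s 0)) (hadd 0 hmem0 0 hmem0)
    have hdφ : deriv φ 0 = 2 * s 0 * deriv s 0 := by
      have h1 : φ =ᶠ[𝓝 0] fun z => s z ^ 2 := by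
        filter_upwards [Metric.isOpen_ball.mem_nhds hmem0] with z hz using (hsq z hz).symm
      rw [h1.deriv_eq, (hds.fun_pow 2).deriv]
      simp
    have h2 : deriv B 0 = deriv s 0 / (2 * s 0) := by
      rw [show deriv B 0 = _ from hdB.deriv]
      field_simp
      ring
    rw [h2, norm_div, norm_mul, Complex.norm_ofNat, div_le_one (by positivity)] at key
    rw [hdφ, ← hsq 0 hmem0, norm_mul, norm_mul, norm_pow, Complex.norm_ofNat]
    nlinarith [norm_nonneg (s 0)]
  · intro z hz w hw h
    simp only [hBdef] at h
    rw [div_eq_div_iff (hadd z hz 0 hmem0) (hadd w hw 0 hmem0)] at h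
    have h1 : 2 * s 0 * (s z - s w) = 0 := by linear_combination h
    have h2 : s z = s w := by simpa [hs0, sub_eq_zero] using h1
    exact hinj hz hw (by rw [← hsq z hz, ← hsq w hw, h2])
  · intro z hz w hw h
    simp only [hBdef] at h
    rw [div_mul_div_comm, div_eq_one_iff_eq
      (mul_ne_zero (hadd z hz 0 hmem0) (hadd w hw 0 hmem0))] at h
    have h1 : 2 * s 0 * (s z + s w) = 0 := by linear_combination -h
    exact hadd z hz w hw (by simpa [hs0] using h1)

/-- A univalent function on a right half-plane omitting `0` has logarithmic derivative at most
`2 / (x - a)` on the real axis. -/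
theorem norm_deriv_le_of_injOn_halfPlane {g : ℂ → ℂ} {a : ℝ}
    (hg : DifferentiableOn ℂ g {z | a < z.re}) (hinj : Set.InjOn g {z | a < z.re})
    (hne : ∀ z : ℂ, a < z.re → g z ≠ 0) {x : ℝ} (hx : a < x) :
    ‖deriv g x‖ ≤ 2 / (x - a) * ‖g x‖ := by
  have hxa : 0 < x - a := sub_pos.2 hx
  set M : ℂ → ℂ := fun z => a + (x - a : ℝ) * ((1 + z) / (1 - z)) with hM
  have hsub : ∀ z ∈ Metric.ball (0 : ℂ) 1, 1 - z ≠ 0 := by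
    intro z hz h
    rw [← sub_eq_zero.1 h] at hz
    simp at hz
  have hmaps : ∀ z ∈ Metric.ball (0 : ℂ) 1, a < (M z).re := by
    intro z hz
    have hz1 : ‖z‖ < 1 := by simpa using hz
    have h1 : Complex.normSq z < 1 := by
      rw [Complex.normSq_eq_norm_sq]; nlinarith [norm_nonneg z]
    have h2 : 0 < Complex.normSq (1 - z) := Complex.normSq_pos.2 (hsub z hz)
    have h3 : ((1 + z) / (1 - z)).re = (1 - Complex.normSq z) / Complex.normSq (1 - z) := by
      rw [Complex.div_re, ← add_div]
      congr 1
      simp [Complex.normSq_apply]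
      ring
    have h4 : 0 < ((1 + z) / (1 - z)).re := by
      rw [h3]; exact div_pos (by linarith) h2
    simp only [hM, Complex.add_re, Complex.ofReal_re, Complex.re_ofReal_mul]
    have := mul_pos hxa h4
    linarith
  have hMd : ∀ z ∈ Metric.ball (0 : ℂ) 1,
      HasDerivAt M ((x - a : ℝ) * ((1 * (1 - z) - (1 + z) * (-1)) / (1 - z) ^ 2)) z := by
    intro z hz
    exact ((((hasDerivAt_id z).const_add 1).div ((hasDerivAt_id z).const_sub 1)
      (hsub z hz)).const_mul _).const_add _
  have hMinj : Set.InjOn M (Metric.ball 0 1) := by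
    intro z hz w hw h
    simp only [hM, add_right_inj] at h
    have h1 := mul_left_cancel₀ (Complex.ofReal_ne_zero.2 hxa.ne') h
    rw [div_eq_div_iff (hsub z hz) (hsub w hw)] at h1
    linear_combination h1 / 2
  have hH : IsOpen {z : ℂ | a < z.re} := isOpen_lt continuous_const Complex.continuous_re
  have hM0 : M 0 = x := by simp [hM]
  have hmem0 : (0 : ℂ) ∈ Metric.ball (0 : ℂ) 1 := by simp
  have key := norm_deriv_le_four_mul_norm (φ := g ∘ M)
    (hg.comp (fun z hz => (hMd z hz).differentiableAt.differentiableWithinAt) hmaps)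
    (hinj.comp hMinj hmaps) (fun z hz => hne _ (hmaps z hz))
  have hgx : HasDerivAt g (deriv g x) (M 0) := by
    rw [hM0]
    exact (hg.differentiableAt (hH.mem_nhds (by simpa using hx))).hasDerivAt
  rw [(hgx.comp 0 (hMd 0 hmem0)).deriv, Function.comp_apply, hM0, norm_mul, norm_mul,
    Complex.norm_of_nonneg hxa.le] at key
  norm_num at key
  rw [div_mul_eq_mul_div, le_div_iff₀ hxa]
  linarith

/-- A univalent function on a right half-plane omitting `0` grows at most quadratically. -/
theorem norm_le_of_injOn_halfPlane {g : ℂ → ℂ} {a : ℝ}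
    (hg : DifferentiableOn ℂ g {z | a < z.re}) (hinj : Set.InjOn g {z | a < z.re})
    (hne : ∀ z : ℂ, a < z.re → g z ≠ 0) {x : ℝ} (hx : a + 1 ≤ x) :
    ‖g x‖ ≤ ‖g (a + 1 : ℝ)‖ * (x - a) ^ 2 := by
  have hH : IsOpen {z : ℂ | a < z.re} := isOpen_lt continuous_const Complex.continuous_re
  have hd : ∀ y : ℝ, a < y → HasDerivAt (fun y : ℝ => ‖g y‖ ^ 2 / (y - a) ^ 4)
      ((2 * inner ℝ (g y) (deriv g y) * (y - a) ^ 4 - ‖g y‖ ^ 2 * (4 * (y - a) ^ 3)) /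
        ((y - a) ^ 4) ^ 2) y := by
    intro y hy
    have h1 : HasDerivAt (fun y : ℝ => g y) (deriv g y) y :=
      (hg.differentiableAt (hH.mem_nhds (by simpa using hy))).hasDerivAt.comp_ofReal
    have h2 : HasDerivAt (fun y : ℝ => (y - a) ^ 4) (4 * (y - a) ^ 3) y := by
      simpa using ((hasDerivAt_id y).sub_const a).fun_pow 4
    exact h1.norm_sq.div h2 (pow_ne_zero _ (sub_pos.2 hy).ne')
  have hanti : AntitoneOn (fun y : ℝ => ‖g y‖ ^ 2 / (y - a) ^ 4) (Set.Ioi a) := by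
    refine antitoneOn_of_deriv_nonpos (convex_Ioi a)
      (fun y hy => (hd y hy).continuousAt.continuousWithinAt)
      (fun y hy => (hd y (interior_subset hy)).differentiableAt.differentiableWithinAt) ?_
    intro y hy
    have hy : a < y := interior_subset hy
    rw [(hd y hy).deriv]
    refine div_nonpos_of_nonpos_of_nonneg ?_ (by positivity)
    have hya : 0 < y - a := sub_pos.2 hy
    have h1 := norm_deriv_le_of_injOn_halfPlane hg hinj hne hy
    rw [div_mul_eq_mul_div, le_div_iff₀ hya] at h1
    have h2 : inner ℝ (g y) (deriv g y) ≤ ‖g y‖ * ‖deriv g y‖ := real_inner_le_norm _ _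
    have h3 : 0 < (y - a) ^ 3 := by positivity
    have h4 : inner ℝ (g y) (deriv g y) * (y - a) ≤ 2 * ‖g y‖ ^ 2 := by
      nlinarith [norm_nonneg (g y), mul_le_mul_of_nonneg_right h2 hya.le,
        mul_le_mul_of_nonneg_left h1 (norm_nonneg (g y))]
    nlinarith [mul_le_mul_of_nonneg_right h4 h3.le]
  have h := hanti (show a + 1 ∈ Set.Ioi a by simp) (show x ∈ Set.Ioi a by simp; linarith) hx
  have hxa : 0 < x - a := by linarith
  simp only [add_sub_cancel_left, one_pow, div_one] at h
  rw [div_le_iff₀ (by positivity)] at h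
  refine le_of_sq_le_sq ?_ (by positivity)
  nlinarith

/-- An entire function of polynomial growth is a polynomial. -/
theorem exists_polynomial_of_norm_le_pow {f : ℂ → ℂ} (hf : Differentiable ℂ f) {C ρ : ℝ} {n : ℕ}
    (hC : ∀ z : ℂ, ρ < ‖z‖ → ‖f z‖ ≤ C * ‖z‖ ^ n) :
    ∃ p : Polynomial ℂ, ∀ z, f z = p.eval z := by
  have hzero : ∀ k, n < k → iteratedDeriv k f 0 = 0 := by
    intro k hk
    have hbound : ∀ᶠ R : ℝ in atTop, ‖iteratedDeriv k f 0‖ ≤ k.factorial * C * (R⁻¹) := by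
      filter_upwards [eventually_gt_atTop ρ, eventually_ge_atTop 1] with R hRρ hR1
      have hR0 : 0 < R := zero_lt_one.trans_le hR1
      have hs : ∀ z ∈ Metric.sphere (0 : ℂ) R, ‖f z‖ ≤ C * R ^ n := fun z hz => by
        have hz : ‖z‖ = R := by simpa using hz
        simpa [hz] using hC z (by rwa [hz])
      have hC0 : 0 ≤ C := by
        have h1 := (norm_nonneg _).trans (hs R (by simp [abs_of_pos hR0]))
        exact nonneg_of_mul_nonneg_left h1 (by positivity)
      refine (Complex.norm_iteratedDeriv_le_of_forall_mem_sphere_norm_le k hR0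
        hf.diffContOnCl hs).trans ?_
      rw [div_le_iff₀ (by positivity)]
      have h2 : R ^ (n + 1) ≤ R ^ k := pow_le_pow_right₀ hR1 hk
      have h3 : R ^ n = R⁻¹ * R ^ (n + 1) := by field_simp; ring
      rw [← mul_assoc, h3, ← mul_assoc]
      gcongr
    have hlim : Tendsto (fun R : ℝ => k.factorial * C * R⁻¹) atTop (𝓝 0) := by
      simpa using tendsto_inv_atTop_zero.const_mul (k.factorial * C)
    exact norm_le_zero_iff.1 (ge_of_tendsto hlim hbound)
  refine ⟨∑ k ∈ Finset.range (n + 1),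
    Polynomial.monomial k ((k.factorial : ℂ)⁻¹ * iteratedDeriv k f 0), fun z => ?_⟩
  rw [← Complex.taylorSeries_eq_of_entire' 0 z hf, Polynomial.eval_finsetSum,
    tsum_eq_sum (s := Finset.range (n + 1))]
  · simp
  · intro k hk
    rw [hzero k (by simpa using hk)]
    simp

/-- An entire function that is bounded away from `0` near infinity is a polynomial. -/
theorem exists_polynomial_of_le_norm {f : ℂ → ℂ} (hf : Differentiable ℂ f) {c ρ : ℝ} (hc : 0 < c)
    (hfc : ∀ z : ℂ, ρ < ‖z‖ → c ≤ ‖f z‖) :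
    ∃ p : Polynomial ℂ, ∀ z, f z = p.eval z := by
  set ρ' := max ρ 1 with hρ'
  have hρ0 : 0 < ρ' := zero_lt_one.trans_le (le_max_right _ _)
  have hlarge : ∀ v ∈ Metric.ball (0 : ℂ) ρ'⁻¹ \ {0}, ρ < ‖v⁻¹‖ := by
    rintro v ⟨hv, hv0⟩
    have hv0 : 0 < ‖v‖ := norm_pos_iff.2 hv0
    rw [norm_inv]
    exact (le_max_left _ _).trans_lt ((lt_inv_comm₀ hv0 hρ0).1 (by simpa using hv))
  have hne : ∀ v ∈ Metric.ball (0 : ℂ) ρ'⁻¹ \ {0}, f v⁻¹ ≠ 0 := fun v hv =>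
    norm_pos_iff.1 (hc.trans_le (hfc _ (hlarge v hv)))
  have hmem : Metric.ball (0 : ℂ) ρ'⁻¹ ∈ 𝓝 (0 : ℂ) := Metric.ball_mem_nhds _ (inv_pos.2 hρ0)
  have hd : DifferentiableOn ℂ (fun v => (f v⁻¹)⁻¹) (Metric.ball (0 : ℂ) ρ'⁻¹ \ {0}) := by
    refine DifferentiableOn.inv (fun v hv => ?_) hne
    exact (hf.differentiableAt.comp v (differentiableAt_inv hv.2)).differentiableWithinAt
  have hb : BddAbove (norm ∘ (fun v => (f v⁻¹)⁻¹) '' (Metric.ball (0 : ℂ) ρ'⁻¹ \ {0})) := by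
    refine ⟨c⁻¹, ?_⟩
    rintro _ ⟨v, hv, rfl⟩
    simp only [Function.comp_apply, norm_inv]
    exact inv_anti₀ hc (hfc _ (hlarge v hv))
  have han := (Complex.differentiableOn_update_limUnder_of_bddAbove hmem hd hb).analyticAt hmem
  set h := Function.update (fun v => (f v⁻¹)⁻¹) 0 (limUnder (𝓝[≠] 0) fun v => (f v⁻¹)⁻¹)
  have hval : ∀ v, v ≠ 0 → h v = (f v⁻¹)⁻¹ := fun v hv => Function.update_of_ne hv _ _
  have hnz : ¬ ∀ᶠ v in 𝓝 (0 : ℂ), h v = 0 := by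
    intro hev
    have h1 : ∀ᶠ v in 𝓝[≠] (0 : ℂ), False := by
      filter_upwards [hev.filter_mono nhdsWithin_le_nhds, mem_nhdsWithin_of_mem_nhds hmem,
        self_mem_nhdsWithin] with v hv hvb hv0
      rw [hval v hv0, inv_eq_zero] at hv
      exact hne v ⟨hvb, hv0⟩ hv
    exact h1.exists.elim fun _ h => h
  obtain ⟨n, k, hk, hk0, hhk⟩ := han.exists_eventuallyEq_pow_smul_nonzero_iff.2 hnz
  have hkb : ∀ᶠ v in 𝓝 (0 : ℂ), ‖k 0‖ / 2 < ‖k v‖ :=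
    hk.continuousAt.norm.eventually (lt_mem_nhds (half_lt_self (norm_pos_iff.2 hk0)))
  obtain ⟨δ, hδ, hδb⟩ := Metric.eventually_nhds_iff.1 (hhk.and hkb)
  refine exists_polynomial_of_norm_le_pow hf (C := (‖k 0‖ / 2)⁻¹) (ρ := δ⁻¹) (n := n) fun z hz => ?_
  have hz0 : 0 < ‖z‖ := (inv_pos.2 hδ).trans hz
  obtain ⟨h1, h2⟩ := hδb (y := z⁻¹) (by
    rw [dist_zero_right, norm_inv]
    exact (inv_lt_comm₀ hδ hz0).1 hz)
  rw [hval _ (inv_ne_zero (norm_pos_iff.1 hz0)), inv_inv, sub_zero] at h1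
  have h3 : f z = z ^ n * (k z⁻¹)⁻¹ := by
    rw [← inv_inv (f z), h1]
    simp [mul_comm]
  have hk2 : 0 < ‖k 0‖ / 2 := half_pos (norm_pos_iff.2 hk0)
  rw [h3, norm_mul, norm_pow, norm_inv, mul_comm]
  gcongr

section Lifting

variable {f : ℂ → ℂ} {R : ℝ}

theorem exists_openPartialHomeomorph_of_deriv_ne_zero (hf : Differentiable ℂ f) {z : ℂ}
    (hz : deriv f z ≠ 0) :
    ∃ e : OpenPartialHomeomorph ℂ ℂ, z ∈ e.source ∧ f = e := by
  have h := ((hf.analyticAt z).hasStrictDerivAt).hasStrictFDerivAt_equiv hz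
  exact ⟨h.toOpenPartialHomeomorph f, h.mem_toOpenPartialHomeomorph_source, rfl⟩

theorem isLocalHomeomorph_restrict_of_deriv_ne_zero (hf : Differentiable ℂ f)
    (hcrit : ∀ z, R < ‖f z‖ → deriv f z ≠ 0) :
    IsLocalHomeomorph fun z : {z // R < ‖f z‖} => f z := by
  have h1 : IsLocalHomeomorphOn f {z | R < ‖f z‖} := fun z hz =>
    exists_openPartialHomeomorph_of_deriv_ne_zero hf (hcrit z hz)
  have h2 : IsOpen {z | R < ‖f z‖} := isOpen_lt continuous_const hf.continuous.norm
  exact isLocalHomeomorph_iff_isLocalHomeomorphOn_univ.2 <|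
    h1.comp h2.isOpenEmbedding_subtypeVal.isLocalHomeomorph.isLocalHomeomorphOn
      fun z _ => z.2

/-- Uniqueness of lifts through `f` over `{w | R < ‖w‖}`. -/
theorem eqOn_of_comp_eqOn_of_lt_norm (hf : Differentiable ℂ f)
    (hcrit : ∀ z, R < ‖f z‖ → deriv f z ≠ 0) {A : Type*} [TopologicalSpace A] {s : Set A}
    (hs : IsPreconnected s) {g₁ g₂ : A → ℂ} (h₁ : ContinuousOn g₁ s) (h₂ : ContinuousOn g₂ s)
    (heq : ∀ x ∈ s, f (g₁ x) = f (g₂ x)) (hR : ∀ x ∈ s, R < ‖f (g₁ x)‖) {x₀ : A} (hx₀ : x₀ ∈ s)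
    (h₀ : g₁ x₀ = g₂ x₀) : Set.EqOn g₁ g₂ s := by
  have : PreconnectedSpace s := isPreconnected_iff_preconnectedSpace.1 hs
  have hloc := isLocalHomeomorph_restrict_of_deriv_ne_zero hf hcrit
  have hR₂ : ∀ x ∈ s, R < ‖f (g₂ x)‖ := fun x hx => heq x hx ▸ hR x hx
  have key := (T2Space.isSeparatedMap fun z : {z // R < ‖f z‖} => f z).eq_of_comp_eq
    hloc.isLocallyInjective
    (g₁ := fun x : s => (⟨g₁ x, hR x x.2⟩ : {z // R < ‖f z‖}))
    (g₂ := fun x : s => (⟨g₂ x, hR₂ x x.2⟩ : {z // R < ‖f z‖}))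
    ((continuousOn_iff_continuous_domRestrict.1 h₁).subtype_mk _)
    ((continuousOn_iff_continuous_domRestrict.1 h₂).subtype_mk _)
    (funext fun x => heq x x.2) ⟨x₀, hx₀⟩ (Subtype.ext h₀)
  exact fun x hx => congrArg Subtype.val (congrFun key ⟨x, hx⟩)

/-- `Γ` is a lift of `γ` on `[0, T]` through `f`, starting at `z₀`. -/
def HasLiftUpTo (f : ℂ → ℂ) (γ : ℝ → ℂ) (z₀ : ℂ) (T : ℝ) (Γ : ℝ → ℂ) : Prop :=
  Γ 0 = z₀ ∧ ContinuousOn Γ (Set.Icc 0 T) ∧ ∀ t ∈ Set.Icc 0 T, f (Γ t) = γ t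

theorem HasLiftUpTo.mono {γ Γ : ℝ → ℂ} {z₀ : ℂ} {S T : ℝ} (h : HasLiftUpTo f γ z₀ T Γ)
    (hST : S ≤ T) : HasLiftUpTo f γ z₀ S Γ :=
  have hsub : Set.Icc 0 S ⊆ Set.Icc 0 T := Set.Icc_subset_Icc_right hST
  ⟨h.1, h.2.1.mono hsub, fun t ht => h.2.2 t (hsub ht)⟩

/-- A lift can be prolonged by means of a local inverse. -/
theorem HasLiftUpTo.extend {γ Γ : ℝ → ℂ} {z₀ : ℂ} {S T : ℝ} (h : HasLiftUpTo f γ z₀ S Γ)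
    (hγ : Continuous γ) (hS : 0 ≤ S) (e : OpenPartialHomeomorph ℂ ℂ) (he : f = e)
    (hmem : Γ S ∈ e.source) (htar : ∀ t ∈ Set.Icc S T, γ t ∈ e.target) :
    ∃ Γ', HasLiftUpTo f γ z₀ T Γ' := by
  classical
  have hglue : e.symm (γ S) = Γ S := by
    rw [← h.2.2 S ⟨hS, le_rfl⟩, he, e.left_inv hmem]
  refine ⟨fun t => if t ≤ S then Γ t else e.symm (γ t), by simp [hS, h.1], ?_, fun t ht => ?_⟩
  · refine ContinuousOn.if ?_ ?_ ?_
    · rintro t ⟨-, ht⟩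
      have : t = S := by
        have := frontier_le_subset_eq continuous_id continuous_const ht
        simpa using this
      rw [this, hglue]
    · refine h.2.1.mono ?_
      rintro t ⟨ht, ht'⟩
      exact ⟨ht.1, closure_minimal (fun _ h => h) isClosed_Iic ht'⟩
    · refine e.continuousOn_symm.comp hγ.continuousOn ?_
      rintro t ⟨ht, ht'⟩
      refine htar t ⟨?_, ht.2⟩
      simp only [not_le] at ht'
      exact closure_lt_subset_le continuous_const continuous_id ht'
  · by_cases hts : t ≤ S
    · simpa [hts] using h.2.2 t ⟨ht.1, hts⟩
    · have := e.right_inv (htar t ⟨(not_le.1 hts).le, ht.2⟩)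
      simpa [hts, he] using this

theorem HasLiftUpTo.eqOn {γ Γ₁ Γ₂ : ℝ → ℂ} {z₀ : ℂ} {T : ℝ} (hf : Differentiable ℂ f)
    (hcrit : ∀ z, R < ‖f z‖ → deriv f z ≠ 0) (hγR : ∀ t, R < ‖γ t‖)
    (h₁ : HasLiftUpTo f γ z₀ T Γ₁) (h₂ : HasLiftUpTo f γ z₀ T Γ₂) :
    Set.EqOn Γ₁ Γ₂ (Set.Icc 0 T) := by
  intro t ht
  refine eqOn_of_comp_eqOn_of_lt_norm hf hcrit isPreconnected_Icc h₁.2.1 h₂.2.1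
    (fun x hx => (h₁.2.2 x hx).trans (h₂.2.2 x hx).symm) (fun x hx => ?_)
    (x₀ := 0) ⟨le_rfl, ht.1.trans ht.2⟩ (h₁.1.trans h₂.1.symm) ht
  rw [h₁.2.2 x hx]
  exact hγR x

/-- Lifts on all `[0, S]` with `S < T` yield a lift on `[0, T]`, unless the lifted curve
tends to infinity, in which case `γ T` is an asymptotic value of `f`. -/
theorem exists_hasLiftUpTo_of_forall_lt (hf : Differentiable ℂ f)
    (hcrit : ∀ z, R < ‖f z‖ → deriv f z ≠ 0) (hasym : ∀ w ∈ asymptoticValues f, ‖w‖ ≤ R)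
    {γ : ℝ → ℂ} (hγ : Continuous γ) (hγR : ∀ t, R < ‖γ t‖) {z₀ : ℂ} {T : ℝ} (hT : 0 < T)
    (h : ∀ S < T, ∃ Γ, HasLiftUpTo f γ z₀ S Γ) :
    ∃ Γ, HasLiftUpTo f γ z₀ T Γ := by
  choose! Λ hΛ using h
  set Γ : ℝ → ℂ := fun t => Λ t t with hΓ
  have hagree : ∀ S < T, Set.EqOn Γ (Λ S) (Set.Icc 0 S) := fun S hS t ht =>
    (hΛ t (ht.2.trans_lt hS)).eqOn hf hcrit hγR ((hΛ S hS).mono ht.2) ⟨ht.1, le_rfl⟩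
  have hlift : ∀ S < T, HasLiftUpTo f γ z₀ S Γ := fun S hS => by
    refine ⟨(hΛ 0 hT).1, (hΛ S hS).2.1.congr (hagree S hS), fun t ht => ?_⟩
    rw [hagree S hS ht]
    exact (hΛ S hS).2.2 t ht
  have hpos : ∀ᶠ t in 𝓝[<] T, 0 < t ∧ t < T :=
    (eventually_mem_nhdsWithin.and (mem_nhdsWithin_of_mem_nhds (lt_mem_nhds hT))).mono
      fun t ht => ⟨ht.2, ht.1⟩
  have hlim : Tendsto (fun t => f (Γ t)) (𝓝[<] T) (𝓝 (γ T)) :=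
    ((hγ.tendsto T).mono_left nhdsWithin_le_nhds).congr' <| hpos.mono fun t ht =>
      ((hlift t ht.2).2.2 t ⟨ht.1.le, le_rfl⟩).symm
  have hnot : ¬ Tendsto (fun t => ‖Γ t‖) (𝓝[<] T) atTop := by
    intro hinf
    set τ : ℝ → ℝ := fun s => T * (1 - (1 + |s|)⁻¹) with hτ
    have hτc : Continuous τ := by
      refine continuous_const.mul (continuous_const.sub (Continuous.inv₀ (by fun_prop) ?_))
      intro s; positivity
    have hτT : ∀ s, τ s < T := fun s => by
      have : 0 < T * (1 + |s|)⁻¹ := by positivity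
      simp only [hτ]; linarith
    have hτ0 : ∀ s, 0 ≤ τ s := fun s => by
      refine mul_nonneg hT.le (sub_nonneg.2 (inv_le_one_of_one_le₀ ?_))
      linarith [abs_nonneg s]
    have hτlim : Tendsto τ atTop (𝓝[<] T) := by
      refine tendsto_nhdsWithin_iff.2 ⟨?_, Eventually.of_forall hτT⟩
      have h1 : Tendsto (fun s : ℝ => (1 + |s|)⁻¹) atTop (𝓝 0) :=
        tendsto_inv_atTop_zero.comp (tendsto_atTop_add_const_left _ _ tendsto_abs_atTop_atTop)
      simpa using (h1.const_sub 1).const_mul T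
    have hmem : γ T ∈ asymptoticValues f := by
      refine ⟨Γ ∘ τ, ?_, hinf.comp hτlim, hlim.comp hτlim⟩
      have hcont : ContinuousOn Γ (Set.Ico 0 T) := by
        intro t ht
        obtain ⟨S, hS, hST⟩ := exists_between ht.2
        refine ((hlift S hST).2.1 t ⟨ht.1, hS.le⟩).mono_of_mem_nhdsWithin ?_
        filter_upwards [self_mem_nhdsWithin, mem_nhdsWithin_of_mem_nhds (gt_mem_nhds hS)]
          with x hx hxS
        exact ⟨hx.1, le_of_lt hxS⟩
      exact hcont.comp_continuous hτc fun s => ⟨hτ0 s, hτT s⟩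
    exact absurd (hasym _ hmem) (not_le.2 (hγR T))
  rw [tendsto_atTop] at hnot
  push Not at hnot
  obtain ⟨M, hM⟩ := hnot
  obtain ⟨z, -, hz⟩ := (isCompact_closedBall (0 : ℂ) M).exists_mapClusterPt_of_frequently
    (l := 𝓝[<] T) (f := Γ) (hM.mono fun t ht => by simpa using ht.le)
  have hfz : f z = γ T := by
    have h1 : MapClusterPt (f z) (𝓝[<] T) (f ∘ Γ) := hz.continuousAt_comp hf.continuous.continuousAt
    exact eq_of_nhds_neBot (h1.neBot.mono (inf_le_inf_left _ hlim))
  obtain ⟨e, hze, he⟩ := exists_openPartialHomeomorph_of_deriv_ne_zero hf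
    (hcrit z (hfz ▸ hγR T))
  have htar : e.target ∈ 𝓝 (γ T) := by
    rw [← hfz, he]
    exact e.open_target.mem_nhds (e.map_source hze)
  obtain ⟨δ, hδ, hδT⟩ := Metric.mem_nhds_iff.1 (hγ.continuousAt.preimage_mem_nhds htar)
  have hnear : ∀ᶠ t in 𝓝[<] T, T - δ < t :=
    mem_nhdsWithin_of_mem_nhds (lt_mem_nhds (by linarith))
  obtain ⟨S, hSe, ⟨hS0, hST⟩, hSδ⟩ :=
    ((hz.frequently (e.open_source.mem_nhds hze)).and_eventually (hpos.and hnear)).exists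
  refine (hlift S hST).extend hγ hS0.le e he hSe fun t ht => hδT ?_
  rw [Metric.mem_ball, Real.dist_eq, abs_lt]
  constructor <;> linarith [ht.1, ht.2]

/-- Path lifting over `{w | R < ‖w‖}`, if this set contains no singular values of `f`. -/
theorem exists_hasLiftUpTo (hf : Differentiable ℂ f)
    (hcrit : ∀ z, R < ‖f z‖ → deriv f z ≠ 0) (hasym : ∀ w ∈ asymptoticValues f, ‖w‖ ≤ R)
    {γ : ℝ → ℂ} (hγ : Continuous γ) (hγR : ∀ t, R < ‖γ t‖) {z₀ : ℂ} (hz₀ : f z₀ = γ 0) :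
    ∃ Γ, HasLiftUpTo f γ z₀ 1 Γ := by
  set s : Set ℝ := {T | ∃ Γ, HasLiftUpTo f γ z₀ T Γ} with hs
  have h0 : (0 : ℝ) ∈ s := ⟨fun _ => z₀, rfl, continuousOn_const, fun t ht => by
    rw [hz₀, le_antisymm ht.2 ht.1]⟩
  have hdown : ∀ T ∈ s, ∀ S ≤ T, S ∈ s := fun T ⟨Γ, hΓ⟩ S hS => ⟨Γ, hΓ.mono hS⟩
  have hclosed : IsClosed s := by
    refine isClosed_of_closure_subset fun T hT => ?_
    rcases le_or_gt T 0 with hT0 | hT0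
    · exact hdown 0 h0 T hT0
    · refine exists_hasLiftUpTo_of_forall_lt hf hcrit hasym hγ hγR hT0 fun S hS => ?_
      obtain ⟨T', hT', hT's⟩ := mem_closure_iff_nhds.1 hT _ (lt_mem_nhds hS)
      exact hdown T' hT's S (le_of_lt hT')
  refine (hclosed.inter isClosed_Icc).Icc_subset_of_forall_mem_nhdsWithin (a := 0) (b := 1) h0 ?_
    (Set.right_mem_Icc.2 zero_le_one)
  rintro T ⟨⟨Γ, hΓ⟩, hT⟩
  have hfz := hΓ.2.2 T ⟨hT.1, le_rfl⟩
  obtain ⟨e, hze, he⟩ := exists_openPartialHomeomorph_of_deriv_ne_zero hf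
    (hcrit (Γ T) (hfz ▸ hγR T))
  have htar : e.target ∈ 𝓝 (γ T) := by
    rw [← hfz, he]
    exact e.open_target.mem_nhds (e.map_source hze)
  obtain ⟨δ, hδ, hδT⟩ := Metric.mem_nhds_iff.1 (hγ.continuousAt.preimage_mem_nhds htar)
  refine mem_nhdsWithin_of_mem_nhds (mem_of_superset (gt_mem_nhds (show T < T + δ by linarith)) ?_)
  intro T' hT'
  refine hΓ.extend hγ hT.1 e he hze fun t ht => hδT ?_
  have : T' < T + δ := hT'
  rw [Metric.mem_ball, Real.dist_eq, abs_lt]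
  constructor <;> linarith [ht.1, ht.2]

end Lifting

section LogarithmicLift

variable {f : ℂ → ℂ} {R : ℝ}

/-- If `{w | R < ‖w‖}` contains no singular values of `f`, then the exponential map on the half
plane `{ζ | log R < ζ.re}` lifts through `f` to a holomorphic map. -/
theorem exists_differentiableOn_comp_eq_exp (hf : Differentiable ℂ f) (hR0 : 0 < R)
    (hcrit : ∀ z, R < ‖f z‖ → deriv f z ≠ 0) (hasym : ∀ w ∈ asymptoticValues f, ‖w‖ ≤ R)
    {z₀ : ℂ} (hz₀ : R < ‖f z₀‖) :
    ∃ g : ℂ → ℂ, DifferentiableOn ℂ g {ζ | Real.log R < ζ.re} ∧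
      ∀ ζ : ℂ, Real.log R < ζ.re → f (g ζ) = Complex.exp ζ := by
  classical
  set H : Set ℂ := {ζ | Real.log R < ζ.re} with hH
  have hHo : IsOpen H := isOpen_lt continuous_const Complex.continuous_re
  have hHc : Convex ℝ H := convex_halfSpace_re_gt _
  have hexp : ∀ ζ ∈ H, R < ‖Complex.exp ζ‖ := fun ζ hζ => by
    rw [Complex.norm_exp]
    exact (Real.log_lt_iff_lt_exp hR0).1 hζ
  have hfz₀ : f z₀ ≠ 0 := norm_pos_iff.1 (hR0.trans hz₀)
  set ζ₀ := Complex.log (f z₀) with hζ₀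
  have hζ₀H : ζ₀ ∈ H := by
    simpa [hH, hζ₀, Complex.log_re] using Real.log_lt_log hR0 hz₀
  set σ : ℝ → ℂ → ℂ := fun t ζ => ζ₀ + (Set.projIcc (0 : ℝ) 1 zero_le_one t : ℝ) * (ζ - ζ₀) with hσ
  have hσH : ∀ t, ∀ ζ ∈ H, σ t ζ ∈ H := fun t ζ hζ => by
    have := hHc.add_smul_sub_mem hζ₀H hζ (Set.projIcc (0 : ℝ) 1 zero_le_one t).2
    simpa [hσ] using this
  have hlift : ∀ ζ : H, ∃ Γ, HasLiftUpTo f (fun t => Complex.exp (σ t ζ)) z₀ 1 Γ := fun ζ => by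
    refine exists_hasLiftUpTo hf hcrit hasym ?_ (fun t => hexp _ (hσH t ζ ζ.2)) ?_
    · have := continuous_projIcc (a := (0 : ℝ)) (b := 1) (h := zero_le_one)
      fun_prop
    · simp [hσ, hζ₀, Complex.exp_log hfz₀]
  choose Γ hΓ using hlift
  have hΓR : ∀ (t : unitInterval) (ζ : H), R < ‖f (Γ ζ t)‖ := fun t ζ => by
    rw [(hΓ ζ).2.2 t t.2]
    exact hexp _ (hσH t ζ ζ.2)
  have hcont := (isLocalHomeomorph_restrict_of_deriv_ne_zero hf hcrit).continuous_lift
    (T2Space.isSeparatedMap _)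
    (⟨fun x : unitInterval × H => Complex.exp (ζ₀ + (x.1 : ℝ) * ((x.2 : ℂ) - ζ₀)), by fun_prop⟩ :
      C(unitInterval × H, ℂ))
    (g := fun x => (⟨Γ x.2 x.1, hΓR x.1 x.2⟩ : {z // R < ‖f z‖}))
    (by
      ext x
      simpa [hσ] using (hΓ x.2).2.2 x.1 x.1.2)
    (by
      refine (continuous_const (y := z₀)).subtype_mk (fun _ => hz₀) |>.congr fun ζ => ?_
      exact Subtype.ext (hΓ ζ).1.symm)
    (fun ζ => ((hΓ ζ).2.1.comp_continuous continuous_subtype_val fun t => t.2).subtype_mk _)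
  set g : ℂ → ℂ := fun ζ => if h : ζ ∈ H then Γ ⟨ζ, h⟩ 1 else 0 with hg
  have hgc : ContinuousOn g H := by
    rw [continuousOn_iff_continuous_domRestrict]
    refine (continuous_subtype_val.comp (hcont.comp (Continuous.prodMk_right 1))).congr fun ζ => ?_
    simp [hg, ζ.2]
  have hgf : ∀ ζ ∈ H, f (g ζ) = Complex.exp ζ := fun ζ hζ => by
    have := (hΓ ⟨ζ, hζ⟩).2.2 1 (Set.right_mem_Icc.2 zero_le_one)
    simpa [hg, hζ, hσ] using this
  refine ⟨g, fun ζ hζ => ?_, hgf⟩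
  have hne := hcrit (g ζ) (by rw [hgf ζ hζ]; exact hexp ζ hζ)
  obtain ⟨e, hze, he⟩ := exists_openPartialHomeomorph_of_deriv_ne_zero hf hne
  have hfg : f (g ζ) ∈ e.target := by
    rw [he]
    exact e.map_source hze
  have hsymm : DifferentiableAt ℂ e.symm (Complex.exp ζ) := by
    rw [← hgf ζ hζ]
    refine (HasDerivAt.of_local_left_inverse (f := f) (f' := deriv f (g ζ))
      (e.continuousAt_symm hfg) ?_ hne ?_).differentiableAt
    · rw [he, e.left_inv hze]
      exact (he ▸ hf _).hasDerivAt
    · filter_upwards [e.open_target.mem_nhds hfg] with w hw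
      rw [he, e.right_inv hw]
  have hgat : ContinuousAt g ζ := hgc.continuousAt (hHo.mem_nhds hζ)
  refine ((hsymm.comp ζ Complex.differentiableAt_exp).congr_of_eventuallyEq
    ?_).differentiableWithinAt
  filter_upwards [hHo.mem_nhds hζ, hgat.preimage_mem_nhds (e.open_source.mem_nhds hze)] with w hw hwe
  rw [Function.comp_apply, ← hgf w hw, he, e.left_inv hwe]

theorem isPreconnected_lt_norm {ρ : ℝ} (hρ : 0 < ρ) : IsPreconnected {z : ℂ | ρ < ‖z‖} := by
  have h : {z : ℂ | ρ < ‖z‖} = Complex.exp '' {ζ | Real.log ρ < ζ.re} := by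
    ext z
    simp only [Set.mem_ofPred_eq, Set.mem_image]
    constructor
    · intro hz
      exact ⟨Complex.log z, by simpa [Complex.log_re] using Real.log_lt_log hρ hz,
        Complex.exp_log (norm_pos_iff.1 (hρ.trans hz))⟩
    · rintro ⟨ζ, hζ, rfl⟩
      rw [Complex.norm_exp]
      exact (Real.log_lt_iff_lt_exp hρ).1 hζ
  rw [h]
  exact (convex_halfSpace_re_gt _).isPreconnected.image _ Complex.continuous_exp.continuousOn

/-- If a lift of `exp` through `f` on a half plane is periodic with a purely imaginary period,
then `f` is a polynomial. -/
theorem exists_polynomial_of_periodic_lift (hf : Differentiable ℂ f) {g : ℂ → ℂ} {a p : ℝ}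
    (hg : DifferentiableOn ℂ g {ζ | a < ζ.re})
    (hgf : ∀ ζ : ℂ, a < ζ.re → f (g ζ) = Complex.exp ζ) (hp : 0 < p)
    (hper : ∀ ζ : ℂ, a < ζ.re → g (ζ + p * Complex.I) = g ζ) :
    ∃ q : Polynomial ℂ, ∀ z, f z = q.eval z := by
  set b := a + 1 with hb
  have hab : a < b := lt_add_one a
  set V := g '' {ζ | b < ζ.re} with hV
  have hsub : {ζ : ℂ | b < ζ.re} ⊆ {ζ | a < ζ.re} := fun ζ hζ => hab.trans hζ
  have hVo : IsOpen V := by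
    have hHo : IsOpen {ζ : ℂ | a < ζ.re} := isOpen_lt continuous_const Complex.continuous_re
    rcases (hg.analyticOnNhd hHo).is_constant_or_isOpen
      (convex_halfSpace_re_gt _).isPreconnected with ⟨w, hw⟩ | h
    · exfalso
      have h1 : (a : ℝ) < ((b : ℝ) : ℂ).re := by simpa using hab
      have h2 : (a : ℝ) < ((b + 1 : ℝ) : ℂ).re := by
        rw [Complex.ofReal_re]
        linarith
      have h3 := hgf _ h1
      rw [hw _ h1, ← hw _ h2, hgf _ h2, ← Complex.ofReal_exp, ← Complex.ofReal_exp,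
        Complex.ofReal_inj, Real.exp_eq_exp] at h3
      linarith
    · exact h _ hsub (isOpen_lt continuous_const Complex.continuous_re)
  have hred : ∀ ζ : ℂ, a < ζ.re → ∃ y ∈ Set.Icc 0 p, g ζ = g (ζ.re + y * Complex.I) := by
    intro ζ hζ
    have hP : Function.Periodic (fun y : ℝ => g (ζ.re + y * Complex.I)) p := fun y => by
      have := hper (ζ.re + y * Complex.I) (by simpa using hζ)
      rw [add_assoc, ← add_mul] at this
      simpa using this
    obtain ⟨y, hy, hy'⟩ := hP.exists_mem_Ico₀ hp ζ.im
    exact ⟨y, Set.Ico_subset_Icc_self hy, by rw [← hy', Complex.re_add_im]⟩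
  have hcomp : ∀ c, IsCompact (g '' (Set.Icc b c ×ℂ Set.Icc 0 p)) := fun c =>
    (isCompact_Icc.reProdIm isCompact_Icc).image_of_continuousOn <|
      hg.continuousOn.mono fun ζ hζ => hab.trans_le hζ.1.1
  have hcl : closure V ⊆ V ∪ g '' (Set.Icc b b ×ℂ Set.Icc 0 p) := by
    intro z hz
    obtain ⟨c, hc⟩ := exists_gt (Real.log (‖f z‖ + 1))
    have hW : IsOpen {w | ‖f w‖ < ‖f z‖ + 1} := isOpen_lt hf.continuous.norm continuous_const
    have hz' : z ∈ closure (g '' (Set.Icc b c ×ℂ Set.Icc 0 p)) := by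
      refine closure_mono ?_ (hW.inter_closure ⟨lt_add_one ‖f z‖, hz⟩)
      rintro _ ⟨hw, ζ, hζ, rfl⟩
      have hζb : b < ζ.re := hζ
      obtain ⟨y, hy, hy'⟩ := hred ζ (hsub hζ)
      rw [hy']
      refine Set.mem_image_of_mem g ⟨?_, by simpa using hy⟩
      have h1 : Real.exp ζ.re < ‖f z‖ + 1 := by
        simpa [hgf ζ (hsub hζ), Complex.norm_exp] using hw
      have h2 := (Real.lt_log_iff_exp_lt (by positivity)).2 h1
      simpa using ⟨hζb.le, (h2.trans hc).le⟩
    rw [(hcomp c).isClosed.closure_eq] at hz'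
    obtain ⟨ζ, hζ, rfl⟩ := hz'
    rcases hζ.1.1.lt_or_eq with h | h
    · exact Or.inl ⟨ζ, h, rfl⟩
    · exact Or.inr ⟨ζ, ⟨⟨h.le, h.ge⟩, hζ.2⟩, rfl⟩
  obtain ⟨ρ, hρ, hρK⟩ := (hcomp b).isBounded.exists_pos_norm_le
  have hne : ({z : ℂ | ρ < ‖z‖} ∩ V).Nonempty := by
    obtain ⟨M, hM⟩ := (isCompact_closedBall (0 : ℂ) ρ).exists_bound_of_continuousOn
      hf.continuous.continuousOn
    obtain ⟨x, hxM, hxb⟩ := ((Real.tendsto_exp_atTop.eventually_gt_atTop M).and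
      (eventually_gt_atTop b)).exists
    refine ⟨g x, ?_, x, by simpa using hxb, rfl⟩
    by_contra hcon
    have h1 := hM (g x) (by simpa using hcon)
    rw [hgf x (by simpa using hab.trans hxb), Complex.norm_exp, Complex.ofReal_re] at h1
    linarith
  have hsubV : {z : ℂ | ρ < ‖z‖} ⊆ V := by
    refine (isPreconnected_lt_norm hρ).subset_of_closure_inter_subset hVo hne ?_
    rintro z ⟨hz, hzρ⟩
    exact (hcl hz).resolve_right fun hK => absurd (hρK z hK) (not_le.2 hzρ)
  refine exists_polynomial_of_le_norm hf (Real.exp_pos b) (ρ := ρ) fun z hz => ?_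
  obtain ⟨ζ, hζ, rfl⟩ := hsubV hz
  rw [hgf ζ (hsub hζ), Complex.norm_exp]
  exact Real.exp_le_exp.2 (le_of_lt hζ)

/-- A lift of `exp` through a transcendental entire function on a half plane is univalent. -/
theorem injOn_of_comp_eq_exp (hf : TranscendentalEntire f) (hR0 : 0 < R)
    (hcrit : ∀ z, R < ‖f z‖ → deriv f z ≠ 0) {g : ℂ → ℂ}
    (hg : DifferentiableOn ℂ g {ζ | Real.log R < ζ.re})
    (hgf : ∀ ζ : ℂ, Real.log R < ζ.re → f (g ζ) = Complex.exp ζ) :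
    Set.InjOn g {ζ | Real.log R < ζ.re} := by
  intro ζ₁ h₁ ζ₂ h₂ heq
  have hexp : Complex.exp ζ₁ = Complex.exp ζ₂ := by rw [← hgf _ h₁, ← hgf _ h₂, heq]
  obtain ⟨n, hn⟩ := Complex.exp_eq_exp_iff_exists_int.1 hexp
  by_contra hne
  have hn0 : n ≠ 0 := by
    rintro rfl
    exact hne (by simpa using hn)
  set p : ℝ := n * (2 * Real.pi) with hp
  have hp0 : p ≠ 0 := by
    have := Real.pi_pos
    positivity
  have hn' : ζ₁ = ζ₂ + p * Complex.I := by
    rw [hn, hp]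
    push_cast
    ring
  have hpexp : ∀ ζ, Complex.exp (ζ + p * Complex.I) = Complex.exp ζ := fun ζ =>
    Complex.exp_eq_exp_iff_exists_int.2 ⟨n, by rw [hp]; push_cast; ring⟩
  have hre : ∀ (ζ : ℂ) (q : ℝ), (ζ + q * Complex.I).re = ζ.re := fun ζ q => by simp
  have hmaps : ∀ ζ : ℂ, Real.log R < ζ.re → Real.log R < (ζ + p * Complex.I).re := fun ζ hζ => by
    rwa [hre]
  have hper : ∀ ζ : ℂ, Real.log R < ζ.re → g (ζ + p * Complex.I) = g ζ := by
    refine eqOn_of_comp_eqOn_of_lt_norm (g₁ := fun ζ => g (ζ + p * Complex.I)) hf.1 hcrit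
      (convex_halfSpace_re_gt _).isPreconnected
      (hg.continuousOn.comp (by fun_prop) hmaps) hg.continuousOn
      (fun ζ hζ => ?_) (fun ζ hζ => ?_) h₂ (hn' ▸ heq)
    · rw [hgf _ (hmaps ζ hζ), hgf _ hζ, hpexp]
    · rw [hgf _ (hmaps ζ hζ), hpexp, Complex.norm_exp]
      exact (Real.log_lt_iff_lt_exp hR0).1 hζ
  refine hf.2 (exists_polynomial_of_periodic_lift hf.1 hg hgf (abs_pos.2 hp0) fun ζ hζ => ?_)
  rcases abs_choice p with h | h
  · rw [h, hper ζ hζ]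
  · rw [h, ← hper _ ((hre ζ (-p)).symm ▸ hζ)]
    congr 1
    push_cast
    ring

end LogarithmicLift

theorem norm_le_maxModulus {f : ℂ → ℂ} (hf : Differentiable ℂ f) {z : ℂ} {r : ℝ} (hr : 0 < r)
    (hz : ‖z‖ ≤ r) : ‖f z‖ ≤ maxModulus f r := by
  refine Complex.norm_le_of_forall_mem_frontier_norm_le (U := Metric.ball 0 r)
    Metric.isBounded_ball hf.diffContOnCl (fun w hw => ?_) ?_
  · rw [frontier_ball _ hr.ne'] at hw
    exact le_csSup ((isCompact_sphere _ _).image hf.continuous.norm).bddAbove ⟨w, hw, rfl⟩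
  · rw [closure_ball _ hr.ne']
    simpa using hz

theorem InClassB.exists_half_log_le {f : ℂ → ℂ} (hf : InClassB f) :
    ∃ C : ℝ, ∀ᶠ r in atTop,
      (1 / 2) * Real.log r - C ≤ Real.log (Real.log (maxModulus f r)) := by
  obtain ⟨hft, hbdd⟩ := hf
  obtain ⟨R₀, hR₀⟩ := hbdd.exists_norm_le
  set R := max (max R₀ 1) ‖f 0‖ with hR
  have hR₀R : R₀ ≤ R := (le_max_left _ _).trans (le_max_left _ _)
  have hR1 : 1 ≤ R := (le_max_right _ _).trans (le_max_left _ _)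
  have hR0 : 0 < R := zero_lt_one.trans_le hR1
  have hcrit : ∀ z, R < ‖f z‖ → deriv f z ≠ 0 := fun z hz hd =>
    absurd ((hR₀ _ (Or.inl ⟨z, hd, rfl⟩)).trans hR₀R) (not_le.2 hz)
  have hasym : ∀ w ∈ asymptoticValues f, ‖w‖ ≤ R := fun w hw => (hR₀ _ (Or.inr hw)).trans hR₀R
  obtain ⟨z₀, hz₀⟩ : ∃ z₀, R < ‖f z₀‖ := by
    by_contra! hcon
    exact hft.2 (exists_polynomial_of_norm_le_pow hft.1 (C := R) (ρ := 0) (n := 0)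
      fun z _ => by simpa using hcon z)
  obtain ⟨g, hg, hgf⟩ := exists_differentiableOn_comp_eq_exp hft.1 hR0 hcrit hasym hz₀
  have hinj := injOn_of_comp_eq_exp hft hR0 hcrit hg hgf
  have ha : 0 ≤ Real.log R := Real.log_nonneg hR1
  have hne : ∀ ζ : ℂ, Real.log R < ζ.re → g ζ ≠ 0 := fun ζ hζ h0 => by
    have h1 := (Real.log_lt_iff_lt_exp hR0).1 hζ
    rw [← Complex.norm_exp, ← hgf ζ hζ, h0] at h1
    exact absurd (le_max_right _ _) (not_le.2 h1)
  set c := ‖g (Real.log R + 1 : ℝ)‖ with hc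
  have hc0 : 0 < c := norm_pos_iff.2 (hne _ (by simp))
  refine ⟨1 / 2 * Real.log c, (eventually_ge_atTop c).mono fun r hr => ?_⟩
  have hr0 : 0 < r := hc0.trans_le hr
  have hq1 : 1 ≤ r / c := (one_le_div hc0).2 hr
  set x := Real.log R + √(r / c) with hx
  have hx1 : Real.log R + 1 ≤ x := by
    have := Real.one_le_sqrt.2 hq1
    linarith
  have hgx : ‖g x‖ ≤ r := by
    refine (norm_le_of_injOn_halfPlane hg hinj hne hx1).trans_eq ?_
    rw [hx, add_sub_cancel_left, Real.sq_sqrt (by positivity), ← hc]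
    field_simp
  have hM : Real.exp x ≤ maxModulus f r := by
    refine le_trans (le_of_eq ?_) (norm_le_maxModulus hft.1 hr0 hgx)
    rw [hgf x (by rw [Complex.ofReal_re]; linarith), Complex.norm_exp, Complex.ofReal_re]
  have hlogM : √(r / c) ≤ Real.log (maxModulus f r) := by
    have h1 := Real.log_le_log (Real.exp_pos x) hM
    rw [Real.log_exp] at h1
    linarith
  refine le_trans (le_of_eq ?_) (Real.log_le_log (by positivity) hlogM)
  rw [Real.log_sqrt (by positivity), Real.log_div hr0.ne' hc0.ne']
  ring

/-- Functions in the class `B` have order at least `1/2`; more precisely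
`log log M(r,f) ≥ (1/2) log r − O(1)`. -/
theorem classB_order_ge_half (f : ℂ → ℂ) (hf : InClassB f) :
    (1 / 2 : EReal) ≤ Filter.limsup
      (fun r => ((Real.log (Real.log (maxModulus f r)) / Real.log r : ℝ) : EReal))
      atTop ∧
    ∃ C : ℝ, ∀ᶠ r in atTop,
      (1 / 2) * Real.log r - C ≤ Real.log (Real.log (maxModulus f r)) := by
  obtain ⟨C, hC⟩ := hf.exists_half_log_le
  refine ⟨?_, C, hC⟩
  have hlim : Tendsto (fun r : ℝ => ((1 / 2 - C / Real.log r : ℝ) : EReal)) atTop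
      (𝓝 ((1 / 2 : ℝ) : EReal)) := by
    refine EReal.tendsto_coe.2 ?_
    simpa using (Real.tendsto_log_atTop.const_div_atTop C).const_sub (1 / 2 : ℝ)
  have hhalf : (1 / 2 : EReal) = ((1 / 2 : ℝ) : EReal) := by
    rw [EReal.coe_div]
    rfl
  rw [hhalf, ← hlim.limsup_eq]
  refine limsup_le_limsup ?_
  filter_upwards [hC, eventually_gt_atTop 1] with r hr hr1
  have hlog : 0 < Real.log r := Real.log_pos hr1
  rw [EReal.coe_le_coe_iff, le_div_iff₀ hlog, sub_mul, div_mul_cancel₀ _ hlog.ne']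
  exact hr
end

section
/- Let R > 0, let H = {w ∈ ℂ : Re w > log R}, and let φ : H → ℂ be an injective holomorphic function whose image φ(H) contains no open disk of radius greater than π. Then |φ'(w)| ≤ 4π/(Re w − log R) for every w ∈ H. -/
open Metric Set ComplexConjugate

/-- A nowhere vanishing holomorphic function on a disk has a holomorphic square root. -/
theorem exists_differentiableOn_sq_eq_on_ball {g : ℂ → ℂ} {c : ℂ} {r : ℝ} (hr : 0 < r)
    (hg : DifferentiableOn ℂ g (ball c r)) (hg0 : ∀ z ∈ ball c r, g z ≠ 0) :
    ∃ k : ℂ → ℂ, DifferentiableOn ℂ k (ball c r) ∧ ∀ z ∈ ball c r, k z ^ 2 = g z := by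
  obtain ⟨L, hL⟩ := ((hg.deriv isOpen_ball).div hg hg0).isExactOn_ball
  have hLd : DifferentiableOn ℂ L (ball c r) := fun z hz =>
    (hL z hz).differentiableAt.differentiableWithinAt
  have hderiv : ∀ z ∈ ball c r, HasDerivAt (fun z => g z * Complex.exp (-L z)) 0 z := by
    intro z hz
    have h := ((hg.differentiableAt (isOpen_ball.mem_nhds hz)).hasDerivAt).mul (hL z hz).neg.cexp
    convert! h using 1
    have := hg0 z hz
    simp only [Pi.div_apply]
    field_simp
    ring
  have hconst : ∀ z ∈ ball c r, g z * Complex.exp (-L z) = g c * Complex.exp (-L c) := by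
    intro z hz
    exact isOpen_ball.is_const_of_deriv_eq_zero (convex_ball c r).isPreconnected
      (fun z hz => (hderiv z hz).differentiableAt.differentiableWithinAt)
      (fun z hz => (hderiv z hz).deriv) hz (mem_ball_self hr)
  obtain ⟨b, hb⟩ := IsAlgClosed.exists_pow_nat_eq (g c * Complex.exp (-L c)) two_pos
  refine ⟨fun z => b * Complex.exp (L z / 2), by fun_prop, fun z hz => ?_⟩
  have h2 : Complex.exp (L z / 2) ^ 2 = Complex.exp (L z) := by
    rw [← Complex.exp_nat_mul]; congr 1; push_cast; ring
  rw [mul_pow, h2, hb, ← hconst z hz, mul_assoc, ← Complex.exp_add]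
  simp

/-- The pseudo-hyperbolic inequality in the disk of radius `A`. -/
theorem norm_mul_sub_le_norm_sq_sub_conj_mul {A : ℝ} {u v : ℂ} (hu : ‖u‖ ≤ A) (hv : ‖v‖ ≤ A) :
    ‖(A : ℂ) * (u - v)‖ ≤ ‖(A : ℂ) ^ 2 - conj v * u‖ := by
  have hA : 0 ≤ A := (norm_nonneg u).trans hu
  rw [← sq_le_sq₀ (norm_nonneg _) (norm_nonneg _)]
  have hu2 : ‖u‖ ^ 2 ≤ A ^ 2 := by gcongr
  have hv2 : ‖v‖ ^ 2 ≤ A ^ 2 := by gcongr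
  have key : ‖(A : ℂ) ^ 2 - conj v * u‖ ^ 2 - ‖(A : ℂ) * (u - v)‖ ^ 2
      = (A ^ 2 - ‖u‖ ^ 2) * (A ^ 2 - ‖v‖ ^ 2) := by
    simp only [Complex.sq_norm, Complex.normSq_apply]
    simp [pow_two]
    ring
  nlinarith [mul_nonneg (sub_nonneg.2 hu2) (sub_nonneg.2 hv2)]

/-- The **Schwarz–Pick inequality** at the centre of the unit disk. -/
theorem norm_deriv_zero_mul_le_of_norm_le {k : ℂ → ℂ} {A : ℝ}
    (hk : DifferentiableOn ℂ k (ball 0 1)) (hA : ∀ z ∈ ball (0 : ℂ) 1, ‖k z‖ ≤ A)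
    (h0 : ‖k 0‖ < A) : ‖deriv k 0‖ * A ≤ A ^ 2 - ‖k 0‖ ^ 2 := by
  have hApos : 0 < A := (norm_nonneg _).trans_lt h0
  have hden : ∀ z ∈ ball (0 : ℂ) 1, (A : ℂ) ^ 2 - conj (k 0) * k z ≠ 0 := by
    intro z hz h
    have h1 : (A : ℂ) ^ 2 = conj (k 0) * k z := sub_eq_zero.1 h
    have h2 := congrArg norm h1
    simp only [norm_pow, Complex.norm_real, norm_mul, RCLike.norm_conj, Real.norm_eq_abs,
      abs_of_pos hApos] at h2
    nlinarith [hA z hz, norm_nonneg (k z), norm_nonneg (k 0)]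
  set q : ℂ → ℂ := fun z => (A : ℂ) * (k z - k 0) / ((A : ℂ) ^ 2 - conj (k 0) * k z) with hq
  have hqd : DifferentiableOn ℂ q (ball 0 1) :=
    ((hk.sub_const _).const_mul _).div ((hk.const_mul _).const_sub _) hden
  have hq0 : q 0 = 0 := by simp [hq]
  have hmaps : MapsTo q (ball 0 1) (closedBall (q 0) 1) := by
    intro z hz
    rw [hq0, mem_closedBall_zero_iff, hq]
    simp only [norm_div]
    exact div_le_one_of_le₀ (norm_mul_sub_le_norm_sq_sub_conj_mul (hA z hz) h0.le) (norm_nonneg _)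
  have hle := Complex.norm_deriv_le_one_of_mapsTo_ball hqd hmaps one_pos
  have hmem : (0 : ℂ) ∈ ball (0 : ℂ) 1 := mem_ball_self one_pos
  have hk0 := (hk.differentiableAt (isOpen_ball.mem_nhds hmem)).hasDerivAt
  have hval : (A : ℂ) ^ 2 - conj (k 0) * k 0 = ((A ^ 2 - ‖k 0‖ ^ 2 : ℝ) : ℂ) := by
    rw [Complex.conj_mul']; push_cast; ring
  have hpos : 0 < A ^ 2 - ‖k 0‖ ^ 2 := by nlinarith [norm_nonneg (k 0)]
  have hqderiv : deriv q 0 = (A : ℂ) * deriv k 0 / ((A ^ 2 - ‖k 0‖ ^ 2 : ℝ) : ℂ) := by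
    have h := ((hk0.sub_const (k 0)).const_mul (A : ℂ)).div
      ((hk0.const_mul (conj (k 0))).const_sub ((A : ℂ) ^ 2)) (hden 0 hmem)
    have h' := h.deriv
    rw [sub_self, mul_zero, zero_mul, sub_zero, pow_two (_ - _), mul_div_mul_right _ _ (hden 0 hmem),
      hval] at h'
    exact h'
  rw [hqderiv, norm_div, norm_mul, Complex.norm_real, Complex.norm_real, Real.norm_of_nonneg hpos.le,
    Real.norm_of_nonneg hApos.le, div_le_one hpos] at hle
  linarith

/-- If `(1 - ‖z‖²) ‖deriv h z‖ ≤ m` on the unit disk, then `h` maps the points of norm at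
most `1/2` to within `5/9 * m` of `h 0`. -/
theorem norm_sub_le_of_norm_deriv_mul_le {h : ℂ → ℂ} {m : ℝ}
    (hd : DifferentiableOn ℂ h (ball 0 1))
    (hm : ∀ z ∈ ball (0 : ℂ) 1, (1 - ‖z‖ ^ 2) * ‖deriv h z‖ ≤ m) {z : ℂ} (hz : ‖z‖ ≤ 1 / 2) :
    ‖h z - h 0‖ ≤ 5 / 9 * m := by
  have hm0 : 0 ≤ m := (by simp : 0 ≤ (1 - ‖(0 : ℂ)‖ ^ 2) * ‖deriv h 0‖).trans
    (hm 0 (mem_ball_self one_pos))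
  have hnorm : ∀ t ∈ Icc (0 : ℝ) 1, ‖(t : ℂ) * z‖ ≤ t / 2 := by
    intro t ht
    rw [norm_mul, Complex.norm_real, Real.norm_of_nonneg ht.1]
    nlinarith [ht.1]
  have hmem : ∀ t ∈ Icc (0 : ℝ) 1, (t : ℂ) * z ∈ ball (0 : ℂ) 1 := by
    intro t ht
    rw [mem_ball_zero_iff]
    linarith [hnorm t ht, ht.2]
  have hder : ∀ t ∈ Icc (0 : ℝ) 1,
      HasDerivAt (fun t : ℝ => h (t * z) - h 0) (deriv h (t * z) * z) t := by
    intro t ht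
    have h1 := (hd.differentiableAt (isOpen_ball.mem_nhds (hmem t ht))).hasDerivAt
    have h2 : HasDerivAt (fun s : ℝ => (s : ℂ) * z) z t := by
      simpa using (Complex.ofRealCLM.hasDerivAt (x := t)).mul_const z
    exact (h1.comp t h2).sub_const _
  have := image_norm_le_of_norm_deriv_right_le_deriv_boundary
    (f := fun t : ℝ => h (t * z) - h 0) (a := 0) (b := 1)
    (f' := fun t => deriv h (t * z) * z)
    (B := fun t => m * (t / 2 + t ^ 3 / 18)) (B' := fun t => m * (1 / 2 + t ^ 2 / 6))
    (fun t ht => (hder t ht).continuousAt.continuousWithinAt)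
    (fun t ht => (hder t ⟨ht.1, ht.2.le⟩).hasDerivWithinAt)
    (by simp)
    (fun t => by
      have := (((hasDerivAt_id t).div_const 2).add ((hasDerivAt_pow 3 t).div_const 18)).const_mul m
      convert! this using 1
      norm_num
      left; ring)
    (fun t ht => by
      have ht' : t ∈ Icc (0 : ℝ) 1 := ⟨ht.1, ht.2.le⟩
      have h1 := hm _ (hmem t ht')
      have h2 := hnorm t ht'
      have h3 : ‖(t : ℂ) * z‖ ^ 2 ≤ t ^ 2 / 4 := by
        nlinarith [norm_nonneg ((t : ℂ) * z)]
      have h4 : (1 - t ^ 2 / 4) * ‖deriv h (t * z)‖ ≤ m :=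
        (mul_le_mul_of_nonneg_right (by linarith) (norm_nonneg _)).trans h1
      have h5 : t ^ 2 ≤ 1 := by nlinarith [ht.1, ht.2]
      have h6 : ‖deriv h (t * z)‖ ≤ m * (1 + t ^ 2 / 3) := by
        have : 1 ≤ (1 - t ^ 2 / 4) * (1 + t ^ 2 / 3) := by nlinarith [sq_nonneg t]
        have h7 : (1 - t ^ 2 / 4) * ‖deriv h (t * z)‖
            ≤ (1 - t ^ 2 / 4) * (m * (1 + t ^ 2 / 3)) := by nlinarith
        exact le_of_mul_le_mul_left h7 (by linarith)
      rw [norm_mul]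
      have : 0 ≤ m * (1 + t ^ 2 / 3) := by positivity
      calc ‖deriv h (t * z)‖ * ‖z‖ ≤ m * (1 + t ^ 2 / 3) * (1 / 2) := by gcongr
        _ = _ := by ring)
    (x := 1) (by simp)
  norm_num at this
  linarith

/-- If `(1 - ‖z‖²) ‖deriv h z‖` attains its maximum `m` at the centre of the unit disk, then the
image of the disk contains the disk of radius `m / 8` centred at `h 0`. -/
theorem ball_subset_image_of_norm_deriv_mul_le {h : ℂ → ℂ} {m : ℝ} (hmpos : 0 < m)
    (hd : DifferentiableOn ℂ h (ball 0 1))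
    (hm : ∀ z ∈ ball (0 : ℂ) 1, (1 - ‖z‖ ^ 2) * ‖deriv h z‖ ≤ m) (h0 : ‖deriv h 0‖ = m) :
    ball (h 0) (m / 8) ⊆ h '' ball 0 1 := by
  intro a ha
  by_contra hna
  have hmem0 : (0 : ℂ) ∈ ball (0 : ℂ) 1 := mem_ball_self one_pos
  have hhalf : ∀ z ∈ ball (0 : ℂ) 1, ‖z / 2‖ ≤ 1 / 2 := by
    intro z hz
    rw [mem_ball_zero_iff] at hz
    rw [norm_div]; norm_num; linarith
  have hmaps : MapsTo (fun z : ℂ => z / 2) (ball 0 1) (ball 0 1) := by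
    intro z hz
    have := hhalf z hz
    rw [mem_ball_zero_iff]; linarith
  have hFd : DifferentiableOn ℂ (fun z => h (z / 2) - a) (ball 0 1) :=
    (hd.comp (by fun_prop) hmaps).sub_const a
  obtain ⟨k, hkd, hk⟩ := exists_differentiableOn_sq_eq_on_ball one_pos hFd
    (fun z hz h' => hna ⟨z / 2, hmaps hz, sub_eq_zero.1 h'⟩)
  have hk0 : k 0 ^ 2 = h 0 - a := by simpa using hk 0 hmem0
  have hδ : ‖k 0‖ ^ 2 < m / 8 := by
    rw [← norm_pow, hk0, ← dist_eq_norm, dist_comm]; exact ha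
  have hderiv : 2 * k 0 * deriv k 0 = deriv h 0 / 2 := by
    have e1 := ((hkd.differentiableAt (isOpen_ball.mem_nhds hmem0)).hasDerivAt).pow 2
    have hh : HasDerivAt h (deriv h 0) ((0 : ℂ) / 2) := by
      simpa using (hd.differentiableAt (isOpen_ball.mem_nhds hmem0)).hasDerivAt
    have e2 := (hh.comp (0 : ℂ) ((hasDerivAt_id (0 : ℂ)).div_const 2)).sub_const a
    have e3 := e1.unique (e2.congr_of_eventuallyEq
      (Filter.eventually_of_mem (isOpen_ball.mem_nhds hmem0) hk))
    simp at e3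
    rw [e3]; ring
  set A := Real.sqrt (5 / 9 * m + ‖k 0‖ ^ 2) with hAdef
  have hA2 : A ^ 2 = 5 / 9 * m + ‖k 0‖ ^ 2 := Real.sq_sqrt (by positivity)
  have hApos : 0 < A := Real.sqrt_pos.2 (by positivity)
  have hbound : ∀ z ∈ ball (0 : ℂ) 1, ‖k z‖ ≤ A := by
    intro z hz
    refine Real.le_sqrt_of_sq_le ?_
    rw [← norm_pow, ← norm_pow, hk z hz, hk0]
    calc ‖h (z / 2) - a‖ = ‖(h (z / 2) - h 0) + (h 0 - a)‖ := by congr 1; ring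
      _ ≤ ‖h (z / 2) - h 0‖ + ‖h 0 - a‖ := norm_add_le _ _
      _ ≤ _ := by gcongr; exact norm_sub_le_of_norm_deriv_mul_le hd hm (hhalf z hz)
  have hlt : ‖k 0‖ < A := Real.lt_sqrt_of_sq_lt (by linarith)
  have hpick := norm_deriv_zero_mul_le_of_norm_le hkd hbound hlt
  have hn := congrArg norm hderiv
  simp only [norm_mul, norm_div, h0, Complex.norm_ofNat] at hn
  have hle : m / 2 * A ≤ 2 * ‖k 0‖ * (5 / 9 * m) := by
    have hmul : ‖deriv k 0‖ * A ≤ 5 / 9 * m := by linarith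
    rw [← hn, mul_assoc]
    exact mul_le_mul_of_nonneg_left hmul (by positivity)
  have hle' : A ≤ 20 / 9 * ‖k 0‖ := le_of_mul_le_mul_left (by linarith) (half_pos hmpos)
  have : A ^ 2 ≤ (20 / 9 * ‖k 0‖) ^ 2 := by gcongr
  nlinarith

/-- A quantitative **Bloch theorem**: if the image of the unit disk under a holomorphic map
contains no disk of radius greater than `s`, the derivative at the centre is at most `8 s`. -/
theorem norm_deriv_zero_le_of_forall_not_ball_subset {f : ℂ → ℂ} {s : ℝ} (hs : 0 ≤ s)
    (hf : DifferentiableOn ℂ f (ball 0 1))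
    (hdisk : ∀ c : ℂ, ∀ r : ℝ, s < r → ¬ ball c r ⊆ f '' ball 0 1) :
    ‖deriv f 0‖ ≤ 8 * s := by
  by_contra! hlt
  have hdpos : 0 < ‖deriv f 0‖ := by linarith
  obtain ⟨ρ, hρ, hρ1⟩ : ∃ ρ : ℝ, 8 * s / ‖deriv f 0‖ < ρ ∧ ρ < 1 :=
    exists_between ((div_lt_one hdpos).2 hlt)
  have hρ0 : 0 < ρ := lt_of_le_of_lt (by positivity) hρ
  rw [div_lt_iff₀ hdpos] at hρ
  have hball : ∀ z ∈ closedBall (0 : ℂ) 1, (ρ : ℂ) * z ∈ ball (0 : ℂ) 1 := by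
    intro z hz
    rw [mem_closedBall_zero_iff] at hz
    rw [mem_ball_zero_iff, norm_mul, Complex.norm_real, Real.norm_of_nonneg hρ0.le]
    nlinarith
  have hg : ∀ z ∈ closedBall (0 : ℂ) 1,
      HasDerivAt (fun z => f (ρ * z)) (deriv f (ρ * z) * ρ) z := by
    intro z hz
    have h1 := (hf.differentiableAt (isOpen_ball.mem_nhds (hball z hz))).hasDerivAt
    exact h1.comp z (by simpa using (hasDerivAt_id z).const_mul (ρ : ℂ))
  have hcont : ContinuousOn (fun z : ℂ => (1 - ‖z‖ ^ 2) * ‖deriv f (ρ * z) * ρ‖)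
      (closedBall 0 1) := by
    have : ContinuousOn (fun z : ℂ => deriv f (ρ * z)) (closedBall 0 1) :=
      (hf.deriv isOpen_ball).continuousOn.comp (by fun_prop) hball
    fun_prop
  obtain ⟨p, hp, hmax⟩ := (isCompact_closedBall (0 : ℂ) 1).exists_isMaxOn
    ⟨0, mem_closedBall_self zero_le_one⟩ hcont
  set m := (1 - ‖p‖ ^ 2) * ‖deriv f (ρ * p) * ρ‖ with hmdef
  have hm8 : 8 * s < m := by
    have := hmax (mem_closedBall_self zero_le_one : (0 : ℂ) ∈ closedBall (0 : ℂ) 1)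
    have h0 : ‖deriv f 0‖ * ρ ≤ m := by simpa [hmdef, abs_of_pos hρ0] using this
    linarith
  have hp1 : ‖p‖ < 1 := by
    refine lt_of_le_of_ne (mem_closedBall_zero_iff.1 hp) fun h => ?_
    simp [hmdef, h] at hm8
    linarith
  have hp2 : 0 < 1 - ‖p‖ ^ 2 := by nlinarith [norm_nonneg p]
  have hden : ∀ z ∈ ball (0 : ℂ) 1, 1 + conj p * z ≠ 0 := by
    intro z hz h
    rw [mem_ball_zero_iff] at hz
    have := congrArg norm (eq_neg_of_add_eq_zero_right h)
    simp only [norm_mul, RCLike.norm_conj, norm_neg, norm_one] at this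
    nlinarith [norm_nonneg p, norm_nonneg z]
  set T : ℂ → ℂ := fun z => (z + p) / (1 + conj p * z) with hT
  have hTid : ∀ z ∈ ball (0 : ℂ) 1,
      1 - ‖T z‖ ^ 2 = (1 - ‖z‖ ^ 2) * ((1 - ‖p‖ ^ 2) / ‖1 + conj p * z‖ ^ 2) := by
    intro z hz
    have h0 : ‖1 + conj p * z‖ ^ 2 ≠ 0 := pow_ne_zero 2 (norm_ne_zero_iff.2 (hden z hz))
    have hsq : ‖1 + conj p * z‖ ^ 2 - ‖z + p‖ ^ 2 = (1 - ‖z‖ ^ 2) * (1 - ‖p‖ ^ 2) := by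
      simp only [Complex.sq_norm, Complex.normSq_apply]
      simp
      ring
    rw [hT, norm_div, div_pow, ← mul_div_assoc, ← hsq, sub_div, div_self h0]
  have hTmaps : MapsTo T (ball 0 1) (ball 0 1) := by
    intro z hz
    have h1 := hTid z hz
    have h2 : 0 < ‖1 + conj p * z‖ := norm_pos_iff.2 (hden z hz)
    rw [mem_ball_zero_iff] at hz ⊢
    have h3 : 0 < 1 - ‖z‖ ^ 2 := by nlinarith [norm_nonneg z]
    have h4 : 0 < 1 - ‖T z‖ ^ 2 := by rw [h1]; positivity
    nlinarith [norm_nonneg (T z)]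
  have hTd : ∀ z ∈ ball (0 : ℂ) 1,
      HasDerivAt T (((1 - ‖p‖ ^ 2 : ℝ) : ℂ) / (1 + conj p * z) ^ 2) z := by
    intro z hz
    have h := ((hasDerivAt_id z).add_const p).div
      (((hasDerivAt_id z).const_mul (conj p)).const_add 1) (hden z hz)
    convert! h using 1
    congr 1
    have : ((1 - ‖p‖ ^ 2 : ℝ) : ℂ) = 1 - conj p * p := by rw [Complex.conj_mul']; push_cast; ring
    rw [this]
    simp
    ring
  have hhd : ∀ z ∈ ball (0 : ℂ) 1, HasDerivAt (fun z => f (ρ * T z))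
      (deriv f (ρ * T z) * ρ * (((1 - ‖p‖ ^ 2 : ℝ) : ℂ) / (1 + conj p * z) ^ 2)) z := by
    intro z hz
    exact (hg (T z) (ball_subset_closedBall (hTmaps hz))).comp z (hTd z hz)
  have hnormd : ∀ z ∈ ball (0 : ℂ) 1, (1 - ‖z‖ ^ 2) * ‖deriv (fun z => f (ρ * T z)) z‖
      = (1 - ‖T z‖ ^ 2) * ‖deriv f (ρ * T z) * ρ‖ := by
    intro z hz
    rw [(hhd z hz).deriv, hTid z hz, norm_mul _ (_ / _), norm_div, norm_pow, Complex.norm_real,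
      Real.norm_of_nonneg hp2.le]
    ring
  have hmem0 : (0 : ℂ) ∈ ball (0 : ℂ) 1 := mem_ball_self one_pos
  have hsub := ball_subset_image_of_norm_deriv_mul_le (h := fun z => f (ρ * T z)) (m := m)
    (by linarith) (fun z hz => (hhd z hz).differentiableAt.differentiableWithinAt)
    (fun z hz => by
      rw [hnormd z hz]
      exact hmax (ball_subset_closedBall (hTmaps hz)))
    (by simpa [hT, hmdef] using hnormd 0 hmem0)
  refine hdisk _ (m / 8) (by linarith) (hsub.trans ?_)
  rintro _ ⟨z, hz, rfl⟩
  exact ⟨ρ * T z, hball _ (ball_subset_closedBall (hTmaps hz)), rfl⟩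

/-- Derivative bound for univalent maps on a half-plane whose image contains
no disk of radius greater than `π` (via Koebe's one quarter theorem). -/
theorem univalent_halfplane_deriv_bound (R : ℝ) (hR : 0 < R) (φ : ℂ → ℂ)
    (hφ : DifferentiableOn ℂ φ {w : ℂ | Real.log R < w.re})
    (hinj : Set.InjOn φ {w : ℂ | Real.log R < w.re})
    (hdisk : ∀ c : ℂ, ∀ r : ℝ, Real.pi < r →
      ¬ Metric.ball c r ⊆ φ '' {w : ℂ | Real.log R < w.re}) :
    ∀ w : ℂ, Real.log R < w.re →
      ‖deriv φ w‖ ≤ 4 * Real.pi / (w.re - Real.log R) := by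
  intro w hw
  set d := w.re - Real.log R with hd
  have hdpos : 0 < d := sub_pos.2 hw
  have hne : ∀ z ∈ ball (0 : ℂ) 1, 1 - z ≠ 0 := by
    intro z hz h
    rw [mem_ball_zero_iff, ← sub_eq_zero.1 h] at hz
    simp at hz
  set C : ℂ → ℂ := fun z => w + 2 * d * (z / (1 - z)) with hC
  have hCre : ∀ z ∈ ball (0 : ℂ) 1, Real.log R < (C z).re := by
    intro z hz
    have h1 : 0 < Complex.normSq (1 - z) := Complex.normSq_pos.2 (hne z hz)
    have h2 : (C z).re - Real.log R = d * ((1 - Complex.normSq z) / Complex.normSq (1 - z)) := by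
      have h3 : (C z).re = w.re + 2 * d * (z / (1 - z)).re := by
        have : C z = w + ((2 * d : ℝ) : ℂ) * (z / (1 - z)) := by simp [hC]
        rw [this, Complex.add_re, Complex.re_ofReal_mul]
      rw [h3, Complex.div_re]
      have : Real.log R = w.re - d := by rw [hd]; ring
      rw [this]
      field_simp
      simp only [Complex.normSq_apply]
      simp
      ring
    have h4 : Complex.normSq z < 1 := by
      rw [Complex.normSq_eq_norm_sq]
      rw [mem_ball_zero_iff] at hz
      nlinarith [norm_nonneg z]
    have : 0 < (C z).re - Real.log R := by
      rw [h2]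
      exact mul_pos hdpos (div_pos (by linarith) h1)
    linarith
  have hopen : IsOpen {w : ℂ | Real.log R < w.re} := isOpen_lt continuous_const Complex.continuous_re
  have hCd : DifferentiableOn ℂ C (ball 0 1) := by
    have : DifferentiableOn ℂ (fun z : ℂ => z / (1 - z)) (ball 0 1) :=
      differentiableOn_id.div (differentiableOn_id.const_sub 1) hne
    exact (this.const_mul _).const_add _
  have hC0 : C 0 = w := by simp [hC]
  have hCderiv : HasDerivAt C (2 * d) 0 := by
    have h := (((hasDerivAt_id (0 : ℂ)).div ((hasDerivAt_id (0 : ℂ)).const_sub 1)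
      (by simp)).const_mul (2 * d : ℂ)).const_add w
    convert! h using 1
    simp
  have hφw : HasDerivAt φ (deriv φ w) (C 0) := by
    rw [hC0]; exact (hφ.differentiableAt (hopen.mem_nhds hw)).hasDerivAt
  have hbloch := norm_deriv_zero_le_of_forall_not_ball_subset (f := φ ∘ C) Real.pi_pos.le
    (hφ.comp hCd hCre) (fun c r hr hsub => hdisk c r hr (hsub.trans (by
      rintro _ ⟨z, hz, rfl⟩
      exact ⟨C z, hCre z hz, rfl⟩)))
  rw [(hφw.comp 0 hCderiv).deriv, norm_mul, norm_mul, Complex.norm_real,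
    Real.norm_of_nonneg hdpos.le, Complex.norm_ofNat] at hbloch
  rw [le_div_iff₀ hdpos]
  linarith
end

section
/- For α ∈ (0,2), the Mittag-Leffler function E_α belongs to the Eremenko–Lyubich class B: the union of the set of critical values of E_α and the set of finite asymptotic values of E_α is a bounded subset of ℂ. -/
open Filter Topology

/-- The Mittag-Leffler function `E_α(z) = Σ_{n≥0} z^n / Γ(αn+1)`. -/
noncomputable def mittagLeffler (α : ℝ) (z : ℂ) : ℂ :=
  ∑' n : ℕ, z ^ n / Complex.Gamma (((α * n + 1 : ℝ) : ℂ))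

namespace MittagLeffler

open Complex MeasureTheory Set

/-- The contour integral of `g` along the boundary of the half-strip
`{w | L < re w, |im w| < φ}`, traversed from `+∞ - φ i` to `+∞ + φ i`. In the coordinate
`u = exp w` this is a Hankel contour. -/
noncomputable def hankelIntegral (φ L : ℝ) (g : ℂ → ℂ) : ℂ :=
  (∫ x : ℝ in Ioi L, g (x + φ * I)) - (∫ x : ℝ in Ioi L, g (x + (-φ : ℝ) * I)) +
    I * ∫ y : ℝ in (-φ)..φ, g (L + y * I)

/-- The integral of `g` along the boundary of the rectangle `[L₁, L₂] × [-φ, φ]`. -/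
noncomputable def rectIntegral (φ L₁ L₂ : ℝ) (g : ℂ → ℂ) : ℂ :=
  (∫ x : ℝ in L₁..L₂, g (x + (-φ : ℝ) * I)) - (∫ x : ℝ in L₁..L₂, g (x + φ * I)) +
    I * (∫ y : ℝ in (-φ)..φ, g (L₂ + y * I)) - I * ∫ y : ℝ in (-φ)..φ, g (L₁ + y * I)

lemma hankelIntegral_sub {φ L₁ L₂ : ℝ} {g : ℂ → ℂ} (hL : L₁ ≤ L₂)
    (h₁ : IntegrableOn (fun x : ℝ => g (x + φ * I)) (Ioi L₁))
    (h₂ : IntegrableOn (fun x : ℝ => g (x + (-φ : ℝ) * I)) (Ioi L₁)) :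
    hankelIntegral φ L₂ g - hankelIntegral φ L₁ g = rectIntegral φ L₁ L₂ g := by
  have key : ∀ f : ℝ → ℂ, IntegrableOn f (Ioi L₁) →
      ∫ x in Ioi L₁, f x = (∫ x in L₁..L₂, f x) + ∫ x in Ioi L₂, f x := fun f hf =>
    (intervalIntegral.integral_interval_add_Ioi hf (hf.mono_set (Ioi_subset_Ioi hL))).symm
  unfold hankelIntegral rectIntegral
  rw [key _ h₁, key _ h₂]
  ring

lemma rectIntegral_eq_zero {φ L₁ L₂ : ℝ} {g : ℂ → ℂ}
    (hg : DifferentiableOn ℂ g (uIcc L₁ L₂ ×ℂ uIcc (-φ) φ)) : rectIntegral φ L₁ L₂ g = 0 := by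
  have := Complex.integral_boundary_rect_eq_zero_of_differentiableOn g
    (L₁ + (-φ : ℝ) * I) (L₂ + φ * I) (by simpa using hg)
  simpa [rectIntegral] using this

lemma norm_exp_exp (x y : ℝ) :
    ‖exp (exp (x + y * I))‖ = Real.exp (Real.exp x * Real.cos y) := by
  rw [Complex.norm_exp, Complex.exp_re]
  simp

lemma image_exp_univ : Real.exp '' univ = Ioi 0 := by
  rw [image_univ, Real.range_exp]

lemma integrable_exp_neg_mul_exp {b c : ℝ} (hb : 0 < b) (hc : c < 0) :
    Integrable fun x : ℝ => Real.exp (Real.exp x * c) * Real.exp (b * x) := by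
  have h := integrableOn_rpow_mul_exp_neg_mul_rpow (p := 1) (s := b - 1) (b := -c)
    (by linarith) one_pos (by linarith)
  rw [← image_exp_univ, integrableOn_image_iff_integrableOn_abs_deriv_smul MeasurableSet.univ
    (fun x _ => (Real.hasDerivAt_exp x).hasDerivWithinAt) Real.exp_injective.injOn,
    integrableOn_univ] at h
  refine h.congr (Eventually.of_forall fun x => ?_)
  simp only [Real.abs_exp, smul_eq_mul, Real.rpow_one, neg_neg]
  rw [← Real.exp_mul, ← mul_assoc, ← Real.exp_add, mul_comm]
  ring_nf

lemma integrableOn_exp_neg_mul_exp {c : ℝ} (b L : ℝ) (hc : c < 0) :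
    IntegrableOn (fun x : ℝ => Real.exp (Real.exp x * c) * Real.exp (b * x)) (Ioi L) := by
  have h := ((integrable_exp_neg_mul_exp (b := |b| + 1) (by positivity) hc).const_mul
    (Real.exp (-(|b| + 1 - b) * L))).integrableOn (s := Ioi L)
  refine h.mono' (by fun_prop) ((ae_restrict_iff' measurableSet_Ioi).2
    (Eventually.of_forall fun x hx => ?_))
  rw [Real.norm_of_nonneg (by positivity), mul_left_comm]
  refine mul_le_mul_of_nonneg_left ?_ (by positivity)
  rw [← Real.exp_add, Real.exp_le_exp]
  have : 0 < |b| + 1 - b := by linarith [le_abs_self b]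
  nlinarith [mem_Ioi.1 hx]

/-- The integrand of the Hankel formula for `1 / Γ(s)` in the coordinate `w = log u`. -/
noncomputable def hankelKernel (s : ℝ) (w : ℂ) : ℂ := exp (exp w) * exp ((1 - s) * w)

lemma norm_hankelKernel (s x y : ℝ) : ‖hankelKernel s (x + y * I)‖ =
    Real.exp (Real.exp x * Real.cos y) * Real.exp ((1 - s) * x) := by
  rw [hankelKernel, norm_mul, norm_exp_exp, Complex.norm_exp]
  simp

lemma differentiable_hankelKernel (s : ℝ) : Differentiable ℂ (hankelKernel s) := by
  unfold hankelKernel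
  fun_prop

lemma continuous_hankelKernel (s : ℝ) : Continuous (hankelKernel s) :=
  (differentiable_hankelKernel s).continuous

lemma integrableOn_hankelKernel (s L : ℝ) {y : ℝ} (hy : Real.cos y < 0) :
    IntegrableOn (fun x : ℝ => hankelKernel s (x + y * I)) (Ioi L) := by
  refine (integrableOn_exp_neg_mul_exp (1 - s) L hy).mono' ?_
    (Eventually.of_forall fun x => (norm_hankelKernel s x y).le)
  exact ((continuous_hankelKernel s).comp (by fun_prop)).aestronglyMeasurable

lemma integral_hankelKernel {s y : ℝ} (hs : s < 1) (hy : exp (y * I) = -1) :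
    ∫ x : ℝ, hankelKernel s (x + y * I) = exp ((1 - s) * (y * I)) * Gamma (1 - s) := by
  have h := integral_cpow_mul_exp_neg_mul_Ioi (a := 1 - s) (r := 1)
    (by simpa using hs) one_pos
  rw [← image_exp_univ, integral_image_eq_integral_abs_deriv_smul MeasurableSet.univ
    (fun x _ => (Real.hasDerivAt_exp x).hasDerivWithinAt) Real.exp_injective.injOn,
    setIntegral_univ] at h
  have e : ∀ x : ℝ, hankelKernel s (x + y * I) = exp ((1 - s) * (y * I)) *
      (|Real.exp x| • ((Real.exp x : ℂ) ^ ((1 : ℂ) - s - 1) *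
        exp (-((1 : ℝ) * (Real.exp x : ℝ))))) := fun x => by
    rw [Real.abs_exp, real_smul, cpow_def_of_ne_zero (by exact_mod_cast (Real.exp_pos x).ne'),
      ← ofReal_log (Real.exp_pos x).le, Real.log_exp, hankelKernel, Complex.exp_add, hy,
      ofReal_exp]
    have : exp ((1 - s) * (x + y * I)) =
      exp ((1 - s) * (y * I)) * (exp x * exp (x * (1 - s - 1))) := by
      rw [← Complex.exp_add, ← Complex.exp_add]; ring_nf
    rw [this]
    push_cast
    ring_nf
  simp_rw [e]
  rw [integral_const_mul, h]
  simp

lemma exp_pi_mul_I_cast : exp ((Real.pi : ℝ) * I) = -1 := exp_pi_mul_I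

lemma exp_neg_pi_mul_I_cast : exp ((-Real.pi : ℝ) * I) = -1 := by
  rw [ofReal_neg, neg_mul, Complex.exp_neg, exp_pi_mul_I]; norm_num

lemma tendsto_integral_vertical_atBot {s : ℝ} (hs : s < 1) (φ : ℝ) :
    Tendsto (fun L : ℝ => ∫ y : ℝ in (-φ)..φ, hankelKernel s (L + y * I)) atBot (𝓝 0) := by
  have h0 : Tendsto (fun L : ℝ => Real.exp (Real.exp L) * Real.exp ((1 - s) * L) *
      |φ - -φ|) atBot (𝓝 (Real.exp 0 * 0 * |φ - -φ|)) := by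
    refine Tendsto.mul_const _ (Tendsto.mul ?_ ?_)
    · exact (Real.continuous_exp.tendsto 0).comp Real.tendsto_exp_atBot
    · exact Real.tendsto_exp_atBot.comp (tendsto_id.const_mul_atBot (by linarith))
  rw [mul_zero, zero_mul] at h0
  refine squeeze_zero_norm (fun L => ?_) h0
  refine intervalIntegral.norm_integral_le_of_norm_le_const fun y _ => ?_
  rw [norm_hankelKernel]
  gcongr
  nlinarith [Real.exp_pos L, Real.cos_le_one y]

lemma hankelIntegral_hankelKernel_congr (s φ L L' : ℝ) (hφ : Real.cos φ < 0) :
    hankelIntegral φ L (hankelKernel s) = hankelIntegral φ L' (hankelKernel s) := by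
  wlog h : L ≤ L' generalizing L L'
  · exact (this L' L (le_of_not_ge h)).symm
  have h2 := hankelIntegral_sub h (integrableOn_hankelKernel s L hφ)
    (integrableOn_hankelKernel s L (by rwa [Real.cos_neg]))
  rw [rectIntegral_eq_zero (differentiable_hankelKernel s).differentiableOn] at h2
  exact (sub_eq_zero.1 h2).symm

lemma integrable_hankelKernel {s y : ℝ} (hs : s < 1) (hy : Real.cos y < 0) :
    Integrable (fun x : ℝ => hankelKernel s (x + y * I)) := by
  refine (integrable_exp_neg_mul_exp (b := 1 - s) (by linarith) hy).mono' ?_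
    (Eventually.of_forall fun x => (norm_hankelKernel s x y).le)
  exact ((continuous_hankelKernel s).comp (by fun_prop)).aestronglyMeasurable

lemma cos_pi_neg : Real.cos Real.pi < 0 := by simp

lemma hankelIntegral_pi_of_lt_one {s : ℝ} (hs₀ : 0 < s) (hs : s < 1) (L : ℝ) :
    hankelIntegral Real.pi L (hankelKernel s) = 2 * Real.pi * I / Gamma s := by
  have htail : ∀ y : ℝ, Real.cos y < 0 →
      Tendsto (fun L : ℝ => ∫ x : ℝ in Ioi L, hankelKernel s (x + y * I)) atBot
        (𝓝 (∫ x : ℝ, hankelKernel s (x + y * I))) := fun y hy =>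
    (aecover_Ioi tendsto_id).integral_tendsto_of_countably_generated
      (integrable_hankelKernel hs hy)
  have hcos : Real.cos (-Real.pi) < 0 := by simp
  have hlim : Tendsto (fun L : ℝ => hankelIntegral Real.pi L (hankelKernel s)) atBot _ :=
    ((htail _ cos_pi_neg).sub (htail _ hcos)).add
      ((tendsto_integral_vertical_atBot hs Real.pi).const_mul I)
  have hval := tendsto_nhds_unique (hlim.congr fun L' =>
    hankelIntegral_hankelKernel_congr s _ L' L cos_pi_neg) tendsto_const_nhds
  rw [← hval, integral_hankelKernel hs exp_pi_mul_I_cast,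
    integral_hankelKernel hs exp_neg_pi_mul_I_cast]
  have hG : Gamma s ≠ 0 := Gamma_ne_zero_of_re_pos (by simpa using hs₀)
  have hsin : sin (Real.pi * s) ≠ 0 := by
    have : 0 < Real.sin (Real.pi * s) :=
      Real.sin_pos_of_pos_of_lt_pi (by positivity) (by nlinarith [Real.pi_pos])
    exact_mod_cast this.ne'
  have hrefl := Complex.Gamma_mul_Gamma_one_sub s
  have hexp : exp ((1 - s) * ((Real.pi : ℝ) * I)) - exp ((1 - s) * ((-Real.pi : ℝ) * I)) =
      2 * I * sin (Real.pi * s) := by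
    have h1 : exp ((1 - s) * ((Real.pi : ℝ) * I)) = -exp (-(Real.pi * s) * I) := by
      rw [← neg_one_mul, ← exp_pi_mul_I, ← Complex.exp_add]; ring_nf
    have h2 : exp ((1 - s) * ((-Real.pi : ℝ) * I)) = -exp (Real.pi * s * I) := by
      rw [← neg_one_mul (exp _), ← exp_neg_pi_mul_I_cast, ← Complex.exp_add]; push_cast; ring_nf
    rw [h1, h2, Complex.sin]
    linear_combination (-(exp (-(Real.pi * s) * I) - exp (Real.pi * s * I))) * I_sq
  rw [mul_zero, add_zero, ← sub_mul, hexp, eq_div_iff hG]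
  rw [eq_div_iff hsin] at hrefl
  linear_combination 2 * I * hrefl

lemma hankelKernel_one (w : ℂ) : hankelKernel 1 w = exp (exp w) := by
  simp [hankelKernel]

lemma hankelIntegral_pi_one (L : ℝ) :
    hankelIntegral Real.pi L (hankelKernel 1) = 2 * Real.pi * I := by
  have h1 : ∀ x : ℝ, hankelKernel 1 (x + (Real.pi : ℝ) * I) =
      hankelKernel 1 (x + (-Real.pi : ℝ) * I) := fun x => by
    simp only [hankelKernel_one, Complex.exp_add, exp_pi_mul_I_cast, exp_neg_pi_mul_I_cast]
  have h2 : ∫ y : ℝ in (-Real.pi)..Real.pi, hankelKernel 1 (L + y * I) = 2 * Real.pi := by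
    have havg : Real.circleAverage exp 0 (Real.exp L) = exp 0 :=
      differentiable_exp.diffContOnCl.circleAverage
    have hper : Function.Periodic (fun y : ℝ => hankelKernel 1 (L + y * I)) (2 * Real.pi) :=
      fun y => by
        simp only [hankelKernel_one]
        congr 1
        rw [← exp_periodic (L + y * I)]
        push_cast
        ring_nf
    have := hper.intervalIntegral_add_eq (-Real.pi) 0
    rw [show -Real.pi + 2 * Real.pi = Real.pi by ring, zero_add] at this
    rw [this]
    have hcm : ∀ y : ℝ, hankelKernel 1 (L + y * I) = exp (circleMap 0 (Real.exp L) y) :=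
      fun y => by rw [hankelKernel_one, circleMap, Complex.exp_add, ofReal_exp, zero_add]
    simp_rw [hcm]
    rw [Real.circleAverage_def, real_smul, Complex.exp_zero] at havg
    have hpi : (Real.pi : ℂ) ≠ 0 := by exact_mod_cast Real.pi_ne_zero
    push_cast at havg
    field_simp at havg
    linear_combination havg
  unfold hankelIntegral
  rw [h2]
  simp_rw [h1]
  ring

lemma integral_hankelKernel_sub {s L y₁ y₂ c : ℝ} (hc : c < 0)
    (hcos : ∀ y ∈ uIcc y₁ y₂, Real.cos y ≤ c) :
    (∫ x : ℝ in Ioi L, hankelKernel s (x + y₁ * I)) -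
      (∫ x : ℝ in Ioi L, hankelKernel s (x + y₂ * I)) =
        I * ∫ y : ℝ in y₁..y₂, hankelKernel s (L + y * I) := by
  have hc₁ : Real.cos y₁ < 0 := (hcos _ left_mem_uIcc).trans_lt hc
  have hc₂ : Real.cos y₂ < 0 := (hcos _ right_mem_uIcc).trans_lt hc
  have hrect : ∀ T : ℝ, (∫ x : ℝ in L..T, hankelKernel s (x + y₁ * I)) -
      (∫ x : ℝ in L..T, hankelKernel s (x + y₂ * I)) +
        I * (∫ y : ℝ in y₁..y₂, hankelKernel s (T + y * I)) =
          I * ∫ y : ℝ in y₁..y₂, hankelKernel s (L + y * I) := fun T => by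
    have := Complex.integral_boundary_rect_eq_zero_of_differentiableOn (hankelKernel s)
      (L + y₁ * I) (T + y₂ * I) (differentiable_hankelKernel s).differentiableOn
    simpa [sub_eq_zero] using this
  have htail : ∀ y : ℝ, Real.cos y < 0 →
      Tendsto (fun T : ℝ => ∫ x : ℝ in L..T, hankelKernel s (x + y * I)) atTop
        (𝓝 (∫ x : ℝ in Ioi L, hankelKernel s (x + y * I))) := fun y hy =>
    intervalIntegral_tendsto_integral_Ioi L (integrableOn_hankelKernel s L hy) tendsto_id
  have hvert : Tendsto (fun T : ℝ => ∫ y : ℝ in y₁..y₂, hankelKernel s (T + y * I)) atTop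
      (𝓝 0) := by
    have h0 : Tendsto (fun T : ℝ => Real.exp (Real.exp T * c) * Real.exp ((1 - s) * T) *
        |y₂ - y₁|) atTop (𝓝 (0 * |y₂ - y₁|)) := by
      refine Tendsto.mul_const _ ?_
      have h1 := (tendsto_rpow_mul_exp_neg_mul_atTop_nhds_zero (1 - s) (-c)
        (by linarith)).comp Real.tendsto_exp_atTop
      refine h1.congr fun T => ?_
      simp only [Function.comp, neg_neg]
      rw [← Real.exp_mul, mul_comm, mul_comm c, mul_comm T]
    rw [zero_mul] at h0
    refine squeeze_zero_norm (fun T => ?_) h0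
    refine intervalIntegral.norm_integral_le_of_norm_le_const fun y hy => ?_
    rw [norm_hankelKernel]
    gcongr
    exact hcos y (uIoc_subset_uIcc hy)
  have hlim := ((htail _ hc₁).sub (htail _ hc₂)).add (hvert.const_mul I)
  have := tendsto_nhds_unique (hlim.congr hrect) tendsto_const_nhds
  simpa using this

lemma hankelIntegral_hankelKernel_eq_pi {φ : ℝ} (h₁ : Real.pi / 2 < φ) (h₂ : φ ≤ Real.pi)
    (s L : ℝ) :
    hankelIntegral φ L (hankelKernel s) = hankelIntegral Real.pi L (hankelKernel s) := by
  have hcos : Real.cos φ < 0 :=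
    Real.cos_neg_of_pi_div_two_lt_of_lt h₁ (by linarith [Real.pi_pos])
  have ha := integral_hankelKernel_sub (s := s) (L := L) (y₁ := φ) (y₂ := Real.pi) hcos
    fun y hy => by
      rw [uIcc_of_le h₂] at hy
      exact Real.cos_le_cos_of_nonneg_of_le_pi (by linarith [Real.pi_pos]) hy.2 hy.1
  have hb := integral_hankelKernel_sub (s := s) (L := L) (y₁ := -Real.pi) (y₂ := -φ) hcos
    fun y hy => by
      rw [uIcc_of_le (by linarith)] at hy
      rw [← Real.cos_neg y]
      exact Real.cos_le_cos_of_nonneg_of_le_pi (by linarith [Real.pi_pos]) (by linarith [hy.1])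
        (by linarith [hy.2])
  have hintegrable : ∀ a b : ℝ,
      IntervalIntegrable (fun y : ℝ => hankelKernel s (L + y * I)) volume a b :=
    fun a b => ((continuous_hankelKernel s).comp (by fun_prop)).intervalIntegrable a b
  have hsplit := intervalIntegral.integral_add_adjacent_intervals
    (hintegrable (-Real.pi) (-φ)) (hintegrable (-φ) φ)
  have hsplit' := intervalIntegral.integral_add_adjacent_intervals
    (hintegrable (-Real.pi) φ) (hintegrable φ Real.pi)
  unfold hankelIntegral
  rw [← hsplit', ← hsplit]
  linear_combination ha + hb

lemma hasDerivAt_hankelKernel (s : ℝ) (w : ℂ) :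
    HasDerivAt (hankelKernel (s + 1)) (hankelKernel s w - s * hankelKernel (s + 1) w) w := by
  have h := (((hasDerivAt_exp w).cexp).mul
    ((hasDerivAt_id w).const_mul (1 - ((s + 1 : ℝ) : ℂ))).cexp)
  have e : exp ((1 - s) * w) = exp w * exp ((1 - ((s + 1 : ℝ) : ℂ)) * w) := by
    rw [← Complex.exp_add]; push_cast; ring_nf
  refine h.congr_deriv ?_
  simp only [hankelKernel, e, id]
  push_cast
  ring

lemma tendsto_hankelKernel_atTop (s : ℝ) {y : ℝ} (hy : Real.cos y < 0) :
    Tendsto (fun x : ℝ => hankelKernel s (x + y * I)) atTop (𝓝 0) := by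
  rw [tendsto_zero_iff_norm_tendsto_zero]
  have h1 := (tendsto_rpow_mul_exp_neg_mul_atTop_nhds_zero (1 - s) (-Real.cos y)
    (by linarith)).comp Real.tendsto_exp_atTop
  refine h1.congr fun T => ?_
  simp only [Function.comp, neg_neg, norm_hankelKernel]
  rw [← Real.exp_mul, mul_comm, mul_comm (Real.cos y), mul_comm T]

lemma hankelIntegral_add_one (s L : ℝ) {φ : ℝ} (hφ : Real.cos φ < 0) :
    s * hankelIntegral φ L (hankelKernel (s + 1)) = hankelIntegral φ L (hankelKernel s) := by
  have hline : ∀ y : ℝ, Real.cos y < 0 →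
      (∫ x : ℝ in Ioi L, hankelKernel s (x + y * I)) -
        s * (∫ x : ℝ in Ioi L, hankelKernel (s + 1) (x + y * I)) =
          -hankelKernel (s + 1) (L + y * I) := fun y hy => by
    have hintegrable := (integrableOn_hankelKernel s L hy).sub
      ((integrableOn_hankelKernel (s + 1) L hy).const_mul (s : ℂ))
    have := integral_Ioi_of_hasDerivAt_of_tendsto' (a := L)
      (f := fun x : ℝ => hankelKernel (s + 1) (x + y * I))
      (fun x _ => ((hasDerivAt_hankelKernel s _).comp_add_const (x : ℂ) (y * I)).comp_ofReal)
      hintegrable (tendsto_hankelKernel_atTop (s + 1) hy)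
    rw [integral_sub (integrableOn_hankelKernel s L hy)
      ((integrableOn_hankelKernel (s + 1) L hy).const_mul (s : ℂ)), integral_const_mul] at this
    rw [this, zero_sub]
  have hvert : I * ((∫ y : ℝ in (-φ)..φ, hankelKernel s (L + y * I)) -
      s * ∫ y : ℝ in (-φ)..φ, hankelKernel (s + 1) (L + y * I)) =
        hankelKernel (s + 1) (L + φ * I) - hankelKernel (s + 1) (L + (-φ : ℝ) * I) := by
    have hci : ∀ t : ℝ, Continuous fun y : ℝ => hankelKernel t (L + y * I) := fun t =>
      (continuous_hankelKernel t).comp (by fun_prop)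
    rw [← intervalIntegral.integral_const_mul,
      ← intervalIntegral.integral_sub ((hci s).intervalIntegrable _ _)
        (((hci (s + 1)).const_mul _).intervalIntegrable _ _),
      ← intervalIntegral.integral_const_mul]
    refine intervalIntegral.integral_eq_sub_of_hasDerivAt
      (f := fun y : ℝ => hankelKernel (s + 1) (L + y * I)) (fun y _ => ?_) ?_
    · have hlin : HasDerivAt (fun y : ℝ => (L : ℂ) + y * I) I y := by
        simpa using ((hasDerivAt_id (y : ℂ)).mul_const I).const_add (L : ℂ) |>.comp_ofReal
      refine ((hasDerivAt_hankelKernel s _).comp y hlin).congr_deriv (by ring)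
    · exact (((hci s).sub ((hci (s + 1)).const_mul _)).const_mul _).intervalIntegrable _ _
  have h₁ := hline φ hφ
  have h₂ := hline (-φ) (by rwa [Real.cos_neg])
  unfold hankelIntegral
  linear_combination h₂ - h₁ - hvert

lemma hankelIntegral_pi {s : ℝ} (hs : 0 < s) (L : ℝ) :
    hankelIntegral Real.pi L (hankelKernel s) = 2 * Real.pi * I / Gamma s := by
  have key : ∀ n : ℕ, ∀ s : ℝ, 0 < s → s ≤ n + 1 →
      hankelIntegral Real.pi L (hankelKernel s) = 2 * Real.pi * I / Gamma s := by
    intro n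
    induction n with
    | zero =>
      intro s hs hs1
      rcases (show s ≤ 1 by simpa using hs1).lt_or_eq with h | rfl
      · exact hankelIntegral_pi_of_lt_one hs h L
      · simpa using hankelIntegral_pi_one L
    | succ n ih =>
      intro s hs hsn
      rcases le_or_gt s (n + 1) with h | h
      · exact ih s hs h
      · have hn : (0 : ℝ) ≤ n := n.cast_nonneg
        have hs' : 0 < s - 1 := by linarith
        have h1 := hankelIntegral_add_one (s - 1) L cos_pi_neg
        rw [ih (s - 1) hs' (by push_cast at hsn; linarith), sub_add_cancel] at h1
        have hne : ((s - 1 : ℝ) : ℂ) ≠ 0 := by exact_mod_cast hs'.ne'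
        have hG := Complex.Gamma_add_one _ hne
        have hG0 : Gamma ((s - 1 : ℝ) : ℂ) ≠ 0 := Gamma_ne_zero_of_re_pos (by simpa using hs')
        rw [show ((s - 1 : ℝ) : ℂ) + 1 = s by push_cast; ring] at hG
        rw [hG, eq_div_iff (mul_ne_zero hne hG0)]
        rw [eq_div_iff hG0] at h1
        linear_combination h1
  obtain ⟨n, hn⟩ := exists_nat_ge s
  exact key n s hs (by linarith)

/-- The Hankel formula for the reciprocal Gamma function. -/
lemma hankelIntegral_hankelKernel {φ s : ℝ} (h₁ : Real.pi / 2 < φ) (h₂ : φ ≤ Real.pi)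
    (hs : 0 < s) (L : ℝ) :
    hankelIntegral φ L (hankelKernel s) = 2 * Real.pi * I / Gamma s := by
  rw [hankelIntegral_hankelKernel_eq_pi h₁ h₂, hankelIntegral_pi hs]

/-- The integrand of the Hankel-type representation of `E_α(exp ζ)`, in the coordinate
`w = log u`. -/
noncomputable def mlKernel (α : ℝ) (ζ w : ℂ) : ℂ := exp (exp w) * (1 - exp (ζ - α * w))⁻¹

lemma pow_mul_hankelKernel (α : ℝ) (ζ w : ℂ) (n : ℕ) :
    exp ζ ^ n * hankelKernel (α * n + 1) w = exp (exp w) * exp (ζ - α * w) ^ n := by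
  rw [hankelKernel, ← Complex.exp_nat_mul, ← Complex.exp_nat_mul, mul_left_comm,
    ← Complex.exp_add]
  push_cast
  ring_nf

lemma norm_exp_sub_mul (α x y : ℝ) (ζ : ℂ) :
    ‖exp (ζ - α * (x + y * I))‖ = Real.exp (ζ.re - α * x) := by
  rw [Complex.norm_exp]; simp

lemma norm_exp_sub_mul_le {α L x : ℝ} (hα : 0 < α) (hx : L ≤ x) (ζ : ℂ) (y : ℝ) :
    ‖exp (ζ - α * (x + y * I))‖ ≤ Real.exp (ζ.re - α * L) := by
  rw [norm_exp_sub_mul, Real.exp_le_exp]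
  nlinarith

lemma hasSum_mlKernel {α : ℝ} {ζ w : ℂ} (h : ‖exp (ζ - α * w)‖ < 1) :
    HasSum (fun n : ℕ => exp ζ ^ n * hankelKernel (α * n + 1) w) (mlKernel α ζ w) := by
  simp_rw [pow_mul_hankelKernel]
  exact (hasSum_geometric_of_norm_lt_one h).mul_left _

lemma norm_pow_mul_hankelKernel_le {α L x : ℝ} (hα : 0 < α) (hx : L ≤ x) (ζ : ℂ) (y : ℝ)
    (n : ℕ) : ‖exp ζ ^ n * hankelKernel (α * n + 1) (x + y * I)‖ ≤
      Real.exp (ζ.re - α * L) ^ n * Real.exp (Real.exp x * Real.cos y) := by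
  rw [pow_mul_hankelKernel, norm_mul, norm_exp_exp, norm_pow, mul_comm]
  gcongr
  exact norm_exp_sub_mul_le hα hx ζ y

lemma hasSum_hankelIntegral_mlKernel {α φ L : ℝ} {ζ : ℂ} (hα : 0 < α)
    (h₁ : Real.pi / 2 < φ) (h₂ : φ ≤ Real.pi) (hζ : ζ.re < α * L) :
    HasSum (fun n : ℕ => exp ζ ^ n / Gamma ((α * n + 1 : ℝ) : ℂ))
      ((2 * Real.pi * I)⁻¹ * hankelIntegral φ L (mlKernel α ζ)) := by
  set q := Real.exp (ζ.re - α * L) with hq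
  have hq0 : 0 ≤ q := (Real.exp_pos _).le
  have hq1 : q < 1 := by rw [hq, Real.exp_lt_one_iff]; linarith
  have hcos : Real.cos φ < 0 :=
    Real.cos_neg_of_pi_div_two_lt_of_lt h₁ (by linarith [Real.pi_pos])
  have hsumq : ∀ b : ℝ, Summable fun n : ℕ => q ^ n * b := fun b =>
    (summable_geometric_of_lt_one hq0 hq1).mul_right b
  have htsum : ∀ b : ℝ, ∑' n : ℕ, q ^ n * b = (1 - q)⁻¹ * b := fun b => by
    rw [tsum_mul_right, tsum_geometric_of_lt_one hq0 hq1]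
  have hpt : ∀ x y : ℝ, L ≤ x → HasSum
      (fun n : ℕ => exp ζ ^ n * hankelKernel (α * n + 1) (x + y * I))
        (mlKernel α ζ (x + y * I)) := fun x y hx =>
    hasSum_mlKernel ((norm_exp_sub_mul_le hα hx ζ y).trans_lt hq1)
  have hline : ∀ y : ℝ, Real.cos y < 0 →
      HasSum (fun n : ℕ => ∫ x : ℝ in Ioi L, exp ζ ^ n * hankelKernel (α * n + 1) (x + y * I))
        (∫ x : ℝ in Ioi L, mlKernel α ζ (x + y * I)) := fun y hy => by
    refine hasSum_integral_of_dominated_convergence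
      (fun n x => q ^ n * Real.exp (Real.exp x * Real.cos y)) (fun n => ?_) (fun n => ?_) ?_ ?_ ?_
    · exact (((continuous_hankelKernel _).comp (by fun_prop)).const_mul _).aestronglyMeasurable
    · exact (ae_restrict_iff' measurableSet_Ioi).2 (Eventually.of_forall fun x hx =>
        norm_pow_mul_hankelKernel_le hα (mem_Ioi.1 hx).le ζ y n)
    · exact Eventually.of_forall fun x => hsumq _
    · simp_rw [htsum]
      have := (integrableOn_exp_neg_mul_exp 0 L hy).const_mul (1 - q)⁻¹
      simpa using this
    · exact (ae_restrict_iff' measurableSet_Ioi).2 (Eventually.of_forall fun x hx =>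
        hpt x y (mem_Ioi.1 hx).le)
  have hvert : HasSum
      (fun n : ℕ => ∫ y : ℝ in (-φ)..φ, exp ζ ^ n * hankelKernel (α * n + 1) (L + y * I))
        (∫ y : ℝ in (-φ)..φ, mlKernel α ζ (L + y * I)) := by
    refine intervalIntegral.hasSum_integral_of_dominated_convergence
      (fun n y => q ^ n * Real.exp (Real.exp L * Real.cos y)) (fun n => ?_) (fun n => ?_) ?_ ?_ ?_
    · exact (((continuous_hankelKernel _).comp (by fun_prop)).const_mul _).aestronglyMeasurable
    · exact Eventually.of_forall fun y _ => norm_pow_mul_hankelKernel_le hα le_rfl ζ y n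
    · exact Eventually.of_forall fun y _ => hsumq _
    · simp_rw [htsum]
      exact Continuous.intervalIntegrable (by fun_prop) _ _
    · exact Eventually.of_forall fun y _ => hpt L y le_rfl
  have hall := ((((hline φ hcos).sub (hline (-φ) (by rwa [Real.cos_neg]))).add
    (hvert.mul_left I))).mul_left (2 * Real.pi * I)⁻¹
  refine hall.congr_fun fun n => ?_
  have hH := hankelIntegral_hankelKernel h₁ h₂ (s := α * n + 1) (by positivity) L
  unfold hankelIntegral at hH
  simp_rw [integral_const_mul, intervalIntegral.integral_const_mul]
  have hne : (2 * Real.pi * I : ℂ) ≠ 0 := by simp [Real.pi_ne_zero]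
  rw [div_eq_mul_inv, eq_inv_mul_iff_mul_eq₀ hne]
  linear_combination (-exp ζ ^ n) * hH

lemma mittagLeffler_exp {α φ L : ℝ} {ζ : ℂ} (hα : 0 < α)
    (h₁ : Real.pi / 2 < φ) (h₂ : φ ≤ Real.pi) (hζ : ζ.re < α * L) :
    2 * Real.pi * I * mittagLeffler α (exp ζ) = hankelIntegral φ L (mlKernel α ζ) := by
  have hne : (2 * Real.pi * I : ℂ) ≠ 0 := by simp [Real.pi_ne_zero]
  rw [mittagLeffler, (hasSum_hankelIntegral_mlKernel hα h₁ h₂ hζ).tsum_eq, mul_inv_cancel_left₀ hne]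

lemma differentiable_mittagLeffler {α : ℝ} (hα : 0 < α) : Differentiable ℂ (mittagLeffler α) := by
  intro z
  have hsum : Summable fun n : ℕ => ‖exp (‖z‖ : ℂ) ^ n / Gamma ((α * n + 1 : ℝ) : ℂ)‖ :=
    (hasSum_hankelIntegral_mlKernel (ζ := ‖z‖) (L := (‖z‖ + 1) / α) hα
      (by linarith [Real.pi_pos]) le_rfl
      (by rw [mul_div_cancel₀ _ hα.ne']; simp)).summable.norm
  have hd : DifferentiableOn ℂ (mittagLeffler α) (Metric.ball 0 (Real.exp ‖z‖)) := by
    refine differentiableOn_tsum_of_summable_norm hsum (fun n => ?_) Metric.isOpen_ball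
      fun n w hw => ?_
    · exact ((differentiable_id.pow n).div_const _).differentiableOn
    · rw [norm_div, norm_div, norm_pow, norm_pow, Complex.norm_exp, ofReal_re]
      gcongr
      exact (mem_ball_zero_iff.1 hw).le
  refine hd.differentiableAt (Metric.isOpen_ball.mem_nhds ?_)
  rw [mem_ball_zero_iff]
  linarith [Real.add_one_le_exp ‖z‖]

/-- The boundary of the rectangle `[L₁, L₂] × [-φ, φ]` is contained in `s`. -/
def RectBoundarySubset (φ L₁ L₂ : ℝ) (s : Set ℂ) : Prop :=
  (∀ x ∈ uIcc L₁ L₂, (x + φ * I : ℂ) ∈ s ∧ (x + (-φ : ℝ) * I : ℂ) ∈ s) ∧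
    ∀ y ∈ uIcc (-φ) φ, (L₁ + y * I : ℂ) ∈ s ∧ (L₂ + y * I : ℂ) ∈ s

lemma rectIntegral_congr {φ L₁ L₂ : ℝ} {s : Set ℂ} {f g : ℂ → ℂ}
    (hs : RectBoundarySubset φ L₁ L₂ s) (h : EqOn f g s) :
    rectIntegral φ L₁ L₂ f = rectIntegral φ L₁ L₂ g := by
  unfold rectIntegral
  rw [intervalIntegral.integral_congr fun x hx => h (hs.1 x hx).1,
    intervalIntegral.integral_congr fun x hx => h (hs.1 x hx).2,
    intervalIntegral.integral_congr fun y hy => h (hs.2 y hy).1,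
    intervalIntegral.integral_congr fun y hy => h (hs.2 y hy).2]

lemma rectIntegral_add {φ L₁ L₂ : ℝ} {s : Set ℂ} {f g : ℂ → ℂ}
    (hs : RectBoundarySubset φ L₁ L₂ s) (hf : ContinuousOn f s) (hg : ContinuousOn g s) :
    rectIntegral φ L₁ L₂ (fun w => f w + g w) =
      rectIntegral φ L₁ L₂ f + rectIntegral φ L₁ L₂ g := by
  have hh : ∀ {k : ℂ → ℂ}, ContinuousOn k s → ∀ {a b : ℝ} {p : ℝ → ℂ}, Continuous p →
      (∀ x ∈ uIcc a b, p x ∈ s) → IntervalIntegrable (fun x => k (p x)) volume a b :=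
    fun hk _ _ _ hp hps => (hk.comp hp.continuousOn hps).intervalIntegrable
  have c₁ : Continuous fun x : ℝ => (x + φ * I : ℂ) := by fun_prop
  have c₂ : Continuous fun x : ℝ => (x + (-φ : ℝ) * I : ℂ) := by fun_prop
  have c₃ : Continuous fun y : ℝ => (L₁ + y * I : ℂ) := by fun_prop
  have c₄ : Continuous fun y : ℝ => (L₂ + y * I : ℂ) := by fun_prop
  unfold rectIntegral
  rw [intervalIntegral.integral_add (hh hf c₁ fun x hx => (hs.1 x hx).1)
      (hh hg c₁ fun x hx => (hs.1 x hx).1),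
    intervalIntegral.integral_add (hh hf c₂ fun x hx => (hs.1 x hx).2)
      (hh hg c₂ fun x hx => (hs.1 x hx).2),
    intervalIntegral.integral_add (hh hf c₃ fun x hx => (hs.2 x hx).1)
      (hh hg c₃ fun x hx => (hs.2 x hx).1),
    intervalIntegral.integral_add (hh hf c₄ fun x hx => (hs.2 x hx).2)
      (hh hg c₄ fun x hx => (hs.2 x hx).2)]
  ring

lemma rectIntegral_const_mul (φ L₁ L₂ : ℝ) (c : ℂ) (f : ℂ → ℂ) :
    rectIntegral φ L₁ L₂ (fun w => c * f w) = c * rectIntegral φ L₁ L₂ f := by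
  unfold rectIntegral
  simp only [intervalIntegral.integral_const_mul]
  ring

lemma integral_inv_sub_horizontal {L₁ L₂ y : ℝ} {w₀ : ℂ} (hy : y - w₀.im ≠ 0) :
    ∫ x : ℝ in L₁..L₂, (x + y * I - w₀)⁻¹ = log (L₂ + y * I - w₀) - log (L₁ + y * I - w₀) := by
  have hm : ∀ x : ℝ, (x + y * I - w₀ : ℂ) ∈ slitPlane := fun x => by
    right; simpa using hy
  have hc : Continuous fun x : ℝ => (x + y * I - w₀ : ℂ) := by fun_prop
  refine intervalIntegral.integral_eq_sub_of_hasDerivAt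
    (f := fun x : ℝ => log (x + y * I - w₀)) (fun x _ => ?_) ?_
  · have hl : HasDerivAt (fun x : ℝ => (x + y * I - w₀ : ℂ)) 1 x := by
      simpa using (((hasDerivAt_id (x : ℂ)).add_const (y * I)).sub_const w₀).comp_ofReal
    simpa using hl.clog_real (hm x)
  · exact (hc.inv₀ fun x => slitPlane_ne_zero (hm x)).intervalIntegrable _ _

lemma integral_inv_sub_vertical {y₁ y₂ x : ℝ} {w₀ : ℂ} {ε : ℂ} (hε : ε * ε = 1)
    (hm : ∀ y : ℝ, ε * (x + y * I - w₀) ∈ slitPlane) :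
    I * ∫ y : ℝ in y₁..y₂, (x + y * I - w₀)⁻¹ =
      log (ε * (x + y₂ * I - w₀)) - log (ε * (x + y₁ * I - w₀)) := by
  have hc : Continuous fun y : ℝ => (x + y * I - w₀ : ℂ) := by fun_prop
  have hne : ∀ y : ℝ, (x + y * I - w₀ : ℂ) ≠ 0 := fun y =>
    right_ne_zero_of_mul (slitPlane_ne_zero (hm y))
  have hε0 : ε ≠ 0 := left_ne_zero_of_mul (hε ▸ one_ne_zero)
  rw [← intervalIntegral.integral_const_mul]
  refine intervalIntegral.integral_eq_sub_of_hasDerivAt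
    (f := fun y : ℝ => log (ε * (x + y * I - w₀))) (fun y _ => ?_) ?_
  · have hl : HasDerivAt (fun y : ℝ => ε * (x + y * I - w₀ : ℂ)) (ε * I) y := by
      simpa using ((((hasDerivAt_id (y : ℂ)).mul_const I).const_add (x : ℂ)).sub_const
        w₀).const_mul ε |>.comp_ofReal
    refine (hl.clog_real (hm y)).congr_deriv ?_
    have := hne y
    field_simp
  · exact ((hc.inv₀ hne).const_mul I).intervalIntegrable _ _

lemma log_neg_of_im_pos {z : ℂ} (hz : 0 < z.im) : log (-z) = log z - Real.pi * I := by
  rw [log, log, norm_neg, arg_neg_eq_arg_sub_pi_of_im_pos hz]; push_cast; ring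

lemma log_neg_of_im_neg {z : ℂ} (hz : z.im < 0) : log (-z) = log z + Real.pi * I := by
  rw [log, log, norm_neg, arg_neg_eq_arg_add_pi_of_im_neg hz]; push_cast; ring

lemma rectIntegral_inv_sub {φ L₁ L₂ : ℝ} {w₀ : ℂ} (h₁ : L₁ < w₀.re) (h₂ : w₀.re < L₂)
    (h₃ : -φ < w₀.im) (h₄ : w₀.im < φ) :
    rectIntegral φ L₁ L₂ (fun w => (w - w₀)⁻¹) = 2 * Real.pi * I := by
  have hr := integral_inv_sub_vertical (y₁ := -φ) (y₂ := φ) (x := L₂) (w₀ := w₀) (ε := 1)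
    (by norm_num) fun y => Or.inl (by simpa using h₂)
  have hl := integral_inv_sub_vertical (y₁ := -φ) (y₂ := φ) (x := L₁) (w₀ := w₀) (ε := -1)
    (by norm_num) fun y => Or.inl (by simpa using h₁)
  have htl := log_neg_of_im_pos (z := L₁ + φ * I - w₀) (by simpa using h₄)
  have hbl := log_neg_of_im_neg (z := L₁ + (-φ : ℝ) * I - w₀) (by simpa using h₃)
  unfold rectIntegral
  rw [integral_inv_sub_horizontal (sub_ne_zero.2 h₃.ne), hr, hl,
    integral_inv_sub_horizontal (sub_ne_zero.2 h₄.ne'), neg_one_mul, neg_one_mul, htl, hbl]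
  ring_nf

/-- The residue theorem on a rectangle for a quotient with a single simple pole. -/
lemma rectIntegral_div {φ L₁ L₂ : ℝ} {w₀ : ℂ} {N D : ℂ → ℂ} (h₁ : L₁ < w₀.re)
    (h₂ : w₀.re < L₂) (h₃ : -φ < w₀.im) (h₄ : w₀.im < φ) (hN : Differentiable ℂ N)
    (hD : Differentiable ℂ D) (hD₀ : D w₀ = 0) (hD' : deriv D w₀ ≠ 0)
    (hne : ∀ w ∈ uIcc L₁ L₂ ×ℂ uIcc (-φ) φ, D w = 0 → w = w₀) :
    rectIntegral φ L₁ L₂ (fun w => N w / D w) = 2 * Real.pi * I * (N w₀ / deriv D w₀) := by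
  set R := uIcc L₁ L₂ ×ℂ uIcc (-φ) φ
  have hL : L₁ ≤ L₂ := (h₁.trans h₂).le
  have hφ : -φ ≤ φ := (h₃.trans h₄).le
  have hR : R ∈ 𝓝 w₀ := by
    have hopen : IsOpen (Ioo L₁ L₂ ×ℂ Ioo (-φ) φ) := isOpen_Ioo.reProdIm isOpen_Ioo
    refine mem_of_superset (hopen.mem_nhds ⟨⟨h₁, h₂⟩, ⟨h₃, h₄⟩⟩) ?_
    rintro w ⟨hw, hw'⟩
    refine ⟨?_, ?_⟩
    · rw [mem_preimage, uIcc_of_le hL]; exact Ioo_subset_Icc_self hw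
    · rw [mem_preimage, uIcc_of_le hφ]; exact Ioo_subset_Icc_self hw'
  have hd : DifferentiableOn ℂ (dslope D w₀) R :=
    (differentiableOn_dslope hR).2 hD.differentiableOn
  have hd0 : ∀ w ∈ R, dslope D w₀ w ≠ 0 := fun w hw => by
    rcases eq_or_ne w w₀ with rfl | hww
    · rwa [dslope_same]
    · rw [dslope_of_ne _ hww, slope_def_field, hD₀, sub_zero]
      exact div_ne_zero (fun h => hww (hne w hw h)) (sub_ne_zero.2 hww)
  set χ : ℂ → ℂ := fun w => N w / dslope D w₀ w with hχ
  have hχd : DifferentiableOn ℂ χ R := hN.differentiableOn.div hd hd0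
  have hkd : DifferentiableOn ℂ (dslope χ w₀) R := (differentiableOn_dslope hR).2 hχd
  have hs : RectBoundarySubset φ L₁ L₂ (R \ {w₀}) := by
    refine ⟨fun x hx => ⟨⟨⟨?_, ?_⟩, ?_⟩, ⟨⟨?_, ?_⟩, ?_⟩⟩,
      fun y hy => ⟨⟨⟨?_, ?_⟩, ?_⟩, ⟨⟨?_, ?_⟩, ?_⟩⟩⟩
    all_goals first
      | (intro h
         rw [mem_singleton_iff] at h
         rw [← h] at h₁ h₂ h₃ h₄
         simp at h₁ h₂ h₃ h₄)
      | (simp; done)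
      | simpa using hx
      | simpa using hy
  have hEq : EqOn (fun w => N w / D w)
      (fun w => χ w₀ * (w - w₀)⁻¹ + dslope χ w₀ w) (R \ {w₀}) := by
    rintro w ⟨hw, hww⟩
    have hww' : w - w₀ ≠ 0 := sub_ne_zero.2 hww
    have hDw : D w ≠ 0 := fun h => hww (hne w hw h)
    have hχw : χ w = N w * (w - w₀) / D w := by
      rw [hχ]
      simp only [dslope_of_ne D hww, slope_def_field, hD₀, sub_zero]
      field_simp
    simp only [dslope_of_ne χ hww, slope_def_field, hχw]
    field_simp
    ring
  have hinv : ContinuousOn (fun w => χ w₀ * (w - w₀)⁻¹) (R \ {w₀}) :=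
    continuousOn_const.mul ((continuousOn_id.sub continuousOn_const).inv₀
      fun w hw => sub_ne_zero.2 hw.2)
  rw [rectIntegral_congr hs hEq, rectIntegral_add hs hinv (hkd.continuousOn.mono sdiff_subset),
    rectIntegral_const_mul, rectIntegral_inv_sub h₁ h₂ h₃ h₄, rectIntegral_eq_zero hkd, hχ]
  simp only [dslope_same]
  ring

lemma exists_pos_le_norm_one_sub_exp {δ : ℝ} (hδ : 0 < δ) (hδ' : δ ≤ Real.pi) :
    ∃ κ > 0, ∀ z : ℂ, δ ≤ |z.im| → |z.im| ≤ 2 * Real.pi - δ → κ ≤ ‖1 - exp z‖ := by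
  have hc : Real.cos δ < 1 := by
    rw [← Real.cos_zero]
    exact Real.cos_lt_cos_of_nonneg_of_le_pi le_rfl hδ' hδ
  set k := max 0 (Real.cos δ) with hk
  have hk0 : 0 ≤ k := le_max_left _ _
  have hk1 : k < 1 := max_lt one_pos hc
  refine ⟨√(1 - k), Real.sqrt_pos.2 (by linarith), fun z h₁ h₂ => ?_⟩
  have hcos : Real.cos z.im ≤ k := by
    refine le_trans ?_ (le_max_right _ _)
    rw [← Real.cos_abs]
    rcases le_total |z.im| Real.pi with h | h
    · exact Real.cos_le_cos_of_nonneg_of_le_pi hδ.le h h₁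
    · rw [← Real.cos_two_pi_sub]
      exact Real.cos_le_cos_of_nonneg_of_le_pi hδ.le (by linarith) (by linarith)
  rw [Complex.norm_def]
  refine Real.sqrt_le_sqrt ?_
  rw [normSq_apply, sub_re, sub_im, one_re, one_im, exp_re, exp_im]
  have hr := Real.exp_pos z.re
  have hsq : (1 - Real.exp z.re * Real.cos z.im) * (1 - Real.exp z.re * Real.cos z.im) +
      (0 - Real.exp z.re * Real.sin z.im) * (0 - Real.exp z.re * Real.sin z.im) =
        1 - 2 * (Real.exp z.re * Real.cos z.im) + Real.exp z.re ^ 2 := by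
    linear_combination Real.exp z.re ^ 2 * Real.sin_sq_add_cos_sq z.im
  rw [hsq]
  nlinarith [mul_le_mul_of_nonneg_left hcos hr.le,
    sq_nonneg (Real.exp z.re - k), mul_nonneg hk0 (sub_nonneg.2 hk1.le)]

lemma norm_mlKernel_le {α κ x y : ℝ} {ζ : ℂ} (hκ : 0 < κ)
    (h : κ ≤ ‖1 - exp (ζ - α * (x + y * I))‖) :
    ‖mlKernel α ζ (x + y * I)‖ ≤ κ⁻¹ * Real.exp (Real.exp x * Real.cos y) := by
  rw [mlKernel, norm_mul, norm_exp_exp, norm_inv, mul_comm]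
  gcongr

lemma integrableOn_mlKernel {α κ y : ℝ} {ζ : ℂ} (hκ : 0 < κ) (hy : Real.cos y < 0)
    (h : ∀ x : ℝ, κ ≤ ‖1 - exp (ζ - α * (x + y * I))‖) (L : ℝ) :
    IntegrableOn (fun x : ℝ => mlKernel α ζ (x + y * I)) (Ioi L) := by
  have hi := (integrableOn_exp_neg_mul_exp 0 L hy).const_mul κ⁻¹
  simp only [zero_mul, Real.exp_zero, mul_one] at hi
  refine hi.mono' ?_ (Eventually.of_forall fun x => norm_mlKernel_le hκ (h x))
  have hc : Continuous fun x : ℝ => mlKernel α ζ (x + y * I) := by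
    unfold mlKernel
    refine Continuous.mul (by fun_prop) (Continuous.inv₀ (by fun_prop) fun x hx => ?_)
    have := h x
    rw [hx, norm_zero] at this
    linarith
  exact hc.aestronglyMeasurable

lemma norm_integral_mlKernel_le {α κ y : ℝ} {ζ : ℂ} (hκ : 0 < κ) (hy : Real.cos y < 0)
    (h : ∀ x : ℝ, κ ≤ ‖1 - exp (ζ - α * (x + y * I))‖) (L : ℝ) :
    ‖∫ x : ℝ in Ioi L, mlKernel α ζ (x + y * I)‖ ≤
      κ⁻¹ * ∫ x : ℝ in Ioi L, Real.exp (Real.exp x * Real.cos y) := by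
  have hi := (integrableOn_exp_neg_mul_exp 0 L hy).const_mul κ⁻¹
  simp only [zero_mul, Real.exp_zero, mul_one] at hi
  rw [← integral_const_mul]
  exact norm_integral_le_of_norm_le hi (Eventually.of_forall fun x => norm_mlKernel_le hκ (h x))

lemma norm_integral_mlKernel_vertical_le {α φ : ℝ} {ζ : ℂ} (hφ : 0 < φ) (hζ : 1 ≤ ζ.re) :
    ‖∫ y : ℝ in (-φ)..φ, mlKernel α ζ ((0 : ℝ) + y * I)‖ ≤ Real.exp 1 * (2 * φ) := by
  have hb : ∀ y ∈ uIoc (-φ) φ, ‖mlKernel α ζ ((0 : ℝ) + y * I)‖ ≤ Real.exp 1 := fun y _ => by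
    have h1 : (1 : ℝ) ≤ ‖1 - exp (ζ - α * ((0 : ℝ) + y * I))‖ := by
      have h2 := norm_sub_norm_le (exp (ζ - α * ((0 : ℝ) + y * I))) 1
      rw [norm_exp_sub_mul, norm_one, norm_sub_rev] at h2
      have h3 := Real.add_one_le_exp (ζ.re - α * 0)
      linarith
    refine (norm_mlKernel_le one_pos h1).trans ?_
    rw [Real.exp_zero, inv_one, one_mul, one_mul]
    exact Real.exp_le_exp.2 (Real.cos_le_one y)
  refine (intervalIntegral.norm_integral_le_of_norm_le_const hb).trans_eq ?_
  rw [sub_neg_eq_add, ← two_mul, abs_of_pos (by linarith)]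

lemma cos_neg_of_pi_div_two_lt {φ : ℝ} (h₁ : Real.pi / 2 < φ) (h₂ : φ ≤ Real.pi) :
    Real.cos φ < 0 :=
  Real.cos_neg_of_pi_div_two_lt_of_lt h₁ (by linarith [Real.pi_pos])

/-- The two horizontal sides of the Hankel contour of height `φ` stay at distance at least `δ`
(modulo `2π`, after rescaling by `α`) from the poles of `mlKernel α ζ`. -/
def AwayFromPoles (α φ δ : ℝ) (ζ : ℂ) : Prop :=
  ∀ y : ℝ, y = φ ∨ y = -φ → δ ≤ |ζ.im - α * y| ∧ |ζ.im - α * y| ≤ 2 * Real.pi - δ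

lemma sub_mul_im (α x y : ℝ) (ζ : ℂ) : (ζ - α * (x + y * I)).im = ζ.im - α * y := by simp

lemma exists_norm_hankelIntegral_le (α : ℝ) {φ δ : ℝ} (h₁ : Real.pi / 2 < φ)
    (h₂ : φ ≤ Real.pi) (hδ : 0 < δ) (hδ' : δ ≤ Real.pi) :
    ∃ M, ∀ ζ : ℂ, 1 ≤ ζ.re → AwayFromPoles α φ δ ζ →
      ‖hankelIntegral φ 0 (mlKernel α ζ)‖ ≤ M := by
  obtain ⟨κ, hκ, hb⟩ := exists_pos_le_norm_one_sub_exp hδ hδ'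
  have hcos := cos_neg_of_pi_div_two_lt h₁ h₂
  refine ⟨(κ⁻¹ * ∫ x : ℝ in Ioi 0, Real.exp (Real.exp x * Real.cos φ)) +
    (κ⁻¹ * ∫ x : ℝ in Ioi 0, Real.exp (Real.exp x * Real.cos (-φ))) + Real.exp 1 * (2 * φ),
    fun ζ hζ hA => ?_⟩
  have hx : ∀ y : ℝ, y = φ ∨ y = -φ → ∀ x : ℝ, κ ≤ ‖1 - exp (ζ - α * (x + y * I))‖ :=
    fun y hy x => hb _ (by rw [sub_mul_im]; exact (hA y hy).1)
      (by rw [sub_mul_im]; exact (hA y hy).2)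
  unfold hankelIntegral
  refine (norm_add_le _ _).trans (add_le_add ((norm_sub_le _ _).trans (add_le_add
    (norm_integral_mlKernel_le hκ hcos (hx φ (Or.inl rfl)) 0)
    (norm_integral_mlKernel_le hκ (by rwa [Real.cos_neg]) (hx (-φ) (Or.inr rfl)) 0))) ?_)
  rw [norm_mul, norm_I, one_mul]
  exact norm_integral_mlKernel_vertical_le (by linarith [Real.pi_pos]) hζ

lemma two_pi_I_mul_mittagLeffler_exp {α φ δ L : ℝ} {ζ : ℂ} (hα : 0 < α)
    (h₁ : Real.pi / 2 < φ) (h₂ : φ ≤ Real.pi) (hδ : 0 < δ) (hδ' : δ ≤ Real.pi)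
    (hA : AwayFromPoles α φ δ ζ) (hL : 0 ≤ L) (hζ : ζ.re < α * L) :
    2 * Real.pi * I * mittagLeffler α (exp ζ) =
      hankelIntegral φ 0 (mlKernel α ζ) + rectIntegral φ 0 L (mlKernel α ζ) := by
  obtain ⟨κ, hκ, hb⟩ := exists_pos_le_norm_one_sub_exp hδ hδ'
  have hcos := cos_neg_of_pi_div_two_lt h₁ h₂
  have hx : ∀ y : ℝ, y = φ ∨ y = -φ → ∀ x : ℝ, κ ≤ ‖1 - exp (ζ - α * (x + y * I))‖ :=
    fun y hy x => hb _ (by rw [sub_mul_im]; exact (hA y hy).1)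
      (by rw [sub_mul_im]; exact (hA y hy).2)
  rw [mittagLeffler_exp hα h₁ h₂ hζ, ← hankelIntegral_sub hL
    (integrableOn_mlKernel hκ hcos (hx φ (Or.inl rfl)) 0)
    (integrableOn_mlKernel hκ (by rwa [Real.cos_neg]) (hx (-φ) (Or.inr rfl)) 0)]
  ring

lemma exists_re_lt_mul {α : ℝ} (hα : 0 < α) (ζ : ℂ) : ∃ L : ℝ, 0 < L ∧ ζ.re < α * L :=
  ⟨(|ζ.re| + 1) / α, by positivity, by
    rw [mul_div_cancel₀ _ hα.ne']; linarith [le_abs_self ζ.re]⟩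

lemma norm_le_of_two_pi_I_mul_eq {a b : ℂ} {M : ℝ} (h : 2 * Real.pi * I * a = b)
    (hb : ‖b‖ ≤ M) : ‖a‖ ≤ M := by
  refine le_trans ?_ hb
  rw [← h, norm_mul, norm_mul, norm_mul, norm_I, Complex.norm_real,
    Real.norm_of_nonneg Real.pi_pos.le, Complex.norm_ofNat]
  nlinarith [norm_nonneg a, Real.pi_gt_three]

/-- Away from the sector of growth, `E_α` is bounded. -/
lemma exists_norm_mittagLeffler_exp_le {α φ θ : ℝ} (hα : 0 < α) (h₁ : Real.pi / 2 < φ)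
    (h₂ : φ ≤ Real.pi) (hφθ : α * φ < θ) (hφ : α * φ < Real.pi) :
    ∃ M, ∀ ζ : ℂ, 1 ≤ ζ.re → θ ≤ |ζ.im| → |ζ.im| ≤ Real.pi →
      ‖mittagLeffler α (exp ζ)‖ ≤ M := by
  have hφ0 : 0 < φ := by linarith [Real.pi_pos]
  have hαφ : 0 < α * φ := mul_pos hα hφ0
  set δ := min (θ - α * φ) (Real.pi - α * φ) with hδdef
  have hδ : 0 < δ := lt_min (by linarith) (by linarith)
  have hδ₁ : δ ≤ θ - α * φ := min_le_left _ _
  have hδ₂ : δ ≤ Real.pi - α * φ := min_le_right _ _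
  obtain ⟨M, hM⟩ := exists_norm_hankelIntegral_le α h₁ h₂ hδ (by linarith)
  refine ⟨M, fun ζ hζ hθ hπ => ?_⟩
  have hstrip : ∀ y : ℝ, |y| ≤ φ → δ ≤ |ζ.im - α * y| ∧ |ζ.im - α * y| ≤ 2 * Real.pi - δ := by
    intro y hy
    have hay : |α * y| ≤ α * φ := by rw [abs_mul, abs_of_pos hα]; gcongr
    have h3 := abs_sub_abs_le_abs_sub ζ.im (α * y)
    have h4 := abs_sub ζ.im (α * y)
    constructor <;> linarith
  have hA : AwayFromPoles α φ δ ζ := by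
    rintro y (rfl | rfl)
    · exact hstrip _ (abs_of_pos hφ0).le
    · exact hstrip _ (by rw [abs_neg, abs_of_pos hφ0])
  obtain ⟨L, hL, hζL⟩ := exists_re_lt_mul hα ζ
  refine norm_le_of_two_pi_I_mul_eq ?_ (hM ζ hζ hA)
  rw [two_pi_I_mul_mittagLeffler_exp hα h₁ h₂ hδ (by linarith) hA hL.le hζL,
    rectIntegral_eq_zero, add_zero]
  obtain ⟨κ, hκ, hb⟩ := exists_pos_le_norm_one_sub_exp hδ (by linarith)
  unfold mlKernel
  refine DifferentiableOn.mul (by fun_prop) (DifferentiableOn.inv (by fun_prop) fun w hw hw0 => ?_)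
  have hwim : |w.im| ≤ φ := by
    have := hw.2
    rw [mem_preimage, uIcc_of_le (by linarith)] at this
    exact abs_le.2 this
  have him : (ζ - α * w).im = ζ.im - α * w.im := by simp
  have := hb (ζ - α * w) (by rw [him]; exact (hstrip _ hwim).1)
    (by rw [him]; exact (hstrip _ hwim).2)
  rw [hw0, norm_zero] at this
  linarith

/-- The exponentially growing part of `E_α`, in logarithmic coordinates. -/
noncomputable def mlGrowth (α : ℝ) (ζ : ℂ) : ℂ := (α : ℂ)⁻¹ * exp (exp (ζ / α))

lemma eq_zero_of_exp_eq_one {z : ℂ} (h : exp z = 1) (him : |z.im| < 2 * Real.pi) : z = 0 := by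
  obtain ⟨n, hn⟩ := exp_eq_one_iff.1 h
  have h2 : z.im = n * (2 * Real.pi) := by rw [hn]; simp
  have hn0 : n = 0 := by
    rw [h2, abs_mul, abs_of_pos Real.two_pi_pos] at him
    have h3 : |(n : ℝ)| < 1 := by
      by_contra! h4
      nlinarith [Real.two_pi_pos]
    exact Int.abs_lt_one_iff.1 (by exact_mod_cast h3)
  simp [hn, hn0]

/-- In the sector of growth, `E_α` agrees with its growing part up to a bounded error. -/
lemma exists_norm_mittagLeffler_exp_sub_le {α φ θ : ℝ} (hα : 0 < α) (h₁ : Real.pi / 2 < φ)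
    (h₂ : φ ≤ Real.pi) (hφθ : θ < α * φ) (hφ : α * φ < Real.pi) :
    ∃ M, ∀ ζ : ℂ, 1 ≤ ζ.re → |ζ.im| ≤ θ →
      ‖mittagLeffler α (exp ζ) - mlGrowth α ζ‖ ≤ M := by
  have hφ0 : 0 < φ := by linarith [Real.pi_pos]
  have hαφ : 0 < α * φ := mul_pos hα hφ0
  set δ := min (α * φ - θ) (Real.pi - α * φ) with hδdef
  have hδ : 0 < δ := lt_min (by linarith) (by linarith)
  have hδ₁ : δ ≤ α * φ - θ := min_le_left _ _
  have hδ₂ : δ ≤ Real.pi - α * φ := min_le_right _ _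
  obtain ⟨M, hM⟩ := exists_norm_hankelIntegral_le α h₁ h₂ hδ (by linarith)
  refine ⟨M, fun ζ hζ hθ => ?_⟩
  have hA : AwayFromPoles α φ δ ζ := by
    intro y hy
    have hay : |α * y| = α * φ := by
      rcases hy with rfl | rfl <;> simp [abs_mul, abs_of_pos hα, abs_of_pos hφ0]
    have h3 := abs_sub_abs_le_abs_sub (α * y) ζ.im
    have h4 := abs_sub ζ.im (α * y)
    rw [abs_sub_comm] at h3
    constructor <;> linarith
  obtain ⟨L, hL, hζL⟩ := exists_re_lt_mul hα ζ
  refine norm_le_of_two_pi_I_mul_eq ?_ (hM ζ hζ hA)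
  rw [mul_sub, two_pi_I_mul_mittagLeffler_exp hα h₁ h₂ hδ (by linarith) hA hL.le hζL]
  have hα' : (α : ℂ) ≠ 0 := ofReal_ne_zero.2 hα.ne'
  have hre : (ζ / α).re = ζ.re / α := div_ofReal_re ζ α
  have him : (ζ / α).im = ζ.im / α := div_ofReal_im ζ α
  have hab := abs_le.1 hθ
  have hder : HasDerivAt (fun w : ℂ => 1 - exp (ζ - α * w)) α (ζ / α) := by
    have h5 : HasDerivAt (fun w : ℂ => ζ - α * w) (-(α * 1)) (ζ / α) :=
      ((hasDerivAt_id (ζ / α)).const_mul (α : ℂ)).const_sub ζ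
    refine (h5.cexp.const_sub 1).congr_deriv ?_
    rw [mul_div_cancel₀ _ hα', sub_self, exp_zero]
    ring
  have hrect := rectIntegral_div (φ := φ) (L₁ := 0) (L₂ := L) (w₀ := ζ / α)
    (N := fun w => exp (exp w)) (D := fun w => 1 - exp (ζ - α * w))
    (by rw [hre]; positivity) (by rw [hre, div_lt_iff₀ hα]; linarith)
    (by rw [him, lt_div_iff₀ hα]; linarith) (by rw [him, div_lt_iff₀ hα]; linarith)
    (by fun_prop) (by fun_prop) (by rw [mul_div_cancel₀ _ hα', sub_self, exp_zero, sub_self])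
    (by rwa [hder.deriv]) (fun w hw hw0 => ?_)
  · rw [hder.deriv] at hrect
    have hk : mlKernel α ζ = fun w => exp (exp w) / (1 - exp (ζ - α * w)) := by
      funext w; rw [mlKernel, div_eq_mul_inv]
    rw [hk, hrect, mlGrowth]
    ring
  · have hwim : |w.im| ≤ φ := by
      have := hw.2
      rw [mem_preimage, uIcc_of_le (by linarith)] at this
      exact abs_le.2 this
    have hay : |α * w.im| ≤ α * φ := by rw [abs_mul, abs_of_pos hα]; gcongr
    have hz : ζ - α * w = 0 := by
      refine eq_zero_of_exp_eq_one (sub_eq_zero.1 hw0).symm ?_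
      have him' : (ζ - α * w).im = ζ.im - α * w.im := by simp
      rw [him']
      have h4 := abs_sub ζ.im (α * w.im)
      linarith
    rw [eq_div_iff hα', mul_comm]
    exact (sub_eq_zero.1 hz).symm

/-- The asymptotics of `E_α` in two overlapping sectors, in logarithmic coordinates. -/
lemma exists_asymptotics {α : ℝ} (hα : 0 < α) (hα2 : α < 2) :
    ∃ θ₁ θ₂ M : ℝ, θ₁ < θ₂ ∧ θ₁ < Real.pi ∧ 0 ≤ M ∧
      (∀ ζ : ℂ, 1 ≤ ζ.re → θ₁ ≤ |ζ.im| → |ζ.im| ≤ Real.pi → ‖mittagLeffler α (exp ζ)‖ ≤ M) ∧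
      ∀ ζ : ℂ, 1 ≤ ζ.re → |ζ.im| ≤ θ₂ → ‖mittagLeffler α (exp ζ) - mlGrowth α ζ‖ ≤ M := by
  have hπ := Real.pi_pos
  obtain ⟨φ₂, hφ₂, hφ₂'⟩ : ∃ φ, Real.pi / 2 < φ ∧ φ < min Real.pi (Real.pi / α) := by
    refine exists_between (lt_min (by linarith) ?_)
    gcongr
  obtain ⟨φ₁, hφ₁, hφ₁₂⟩ := exists_between hφ₂
  have hφ₂π : φ₂ < Real.pi := hφ₂'.trans_le (min_le_left _ _)
  have hαφ₂ : α * φ₂ < Real.pi := by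
    rw [mul_comm, ← lt_div_iff₀ hα]
    exact hφ₂'.trans_le (min_le_right _ _)
  have hαφ : α * φ₁ < α * φ₂ := by gcongr
  obtain ⟨θ₂, hθ₂, hθ₂'⟩ := exists_between hαφ
  obtain ⟨θ₁, hθ₁, hθ₁₂⟩ := exists_between hθ₂
  obtain ⟨M₁, hM₁⟩ := exists_norm_mittagLeffler_exp_le hα hφ₁ (by linarith) hθ₁ (by linarith)
  obtain ⟨M₂, hM₂⟩ := exists_norm_mittagLeffler_exp_sub_le hα hφ₂ hφ₂π.le hθ₂' hαφ₂
  refine ⟨θ₁, θ₂, max 0 (max M₁ M₂), hθ₁₂, by linarith, le_max_left _ _, fun ζ h h' h'' => ?_,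
    fun ζ h h' => ?_⟩
  · exact (hM₁ ζ h h' h'').trans ((le_max_left _ _).trans (le_max_right _ _))
  · exact (hM₂ ζ h h').trans ((le_max_right _ _).trans (le_max_right _ _))

lemma hasDerivAt_mlGrowth (α : ℝ) (ζ : ℂ) :
    HasDerivAt (mlGrowth α) ((α : ℂ)⁻¹ * exp (ζ / α) * mlGrowth α ζ) ζ := by
  have h := ((((hasDerivAt_id ζ).div_const (α : ℂ)).cexp).cexp).const_mul (α : ℂ)⁻¹
  refine h.congr_deriv ?_
  simp only [id, mlGrowth]
  ring

lemma norm_exp_div {α : ℝ} (ζ : ℂ) : ‖exp (ζ / α)‖ = Real.exp (ζ.re / α) := by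
  rw [Complex.norm_exp, div_ofReal_re]

lemma isBounded_criticalValues {α : ℝ} (hα : 0 < α) (hα2 : α < 2) :
    Bornology.IsBounded (criticalValues (mittagLeffler α)) := by
  obtain ⟨θ₁, θ₂, M, hθ, -, hM, hb, hg⟩ := exists_asymptotics hα hα2
  have hE := differentiable_mittagLeffler hα
  obtain ⟨C, hC⟩ := (isCompact_closedBall (0 : ℂ) (Real.exp 2)).exists_bound_of_continuousOn
    hE.continuous.continuousOn
  set δ := min 1 (θ₂ - θ₁) with hδ
  have hδ0 : 0 < δ := lt_min one_pos (by linarith)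
  refine isBounded_iff_forall_norm_le.2 ⟨max C (M + α * (M / δ)), ?_⟩
  rintro _ ⟨z, hz, rfl⟩
  rcases le_or_gt ‖z‖ (Real.exp 2) with hz2 | hz2
  · exact (hC z (mem_closedBall_zero_iff.2 hz2)).trans (le_max_left _ _)
  refine le_trans ?_ (le_max_right _ _)
  have hz0 : z ≠ 0 := norm_pos_iff.1 ((Real.exp_pos 2).trans hz2)
  obtain ⟨ζ, hζ⟩ : ∃ ζ, ζ = log z := ⟨_, rfl⟩
  have hzexp : exp ζ = z := by rw [hζ, exp_log hz0]
  have hre : 2 < ζ.re := by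
    rw [hζ, log_re, Real.lt_log_iff_exp_lt (norm_pos_iff.2 hz0)]
    exact hz2
  have him : |ζ.im| ≤ Real.pi := by rw [hζ, log_im]; exact abs_arg_le_pi z
  have hMδ : 0 ≤ α * (M / δ) := by positivity
  rcases le_or_gt θ₁ |ζ.im| with h | h
  · rw [← hzexp]
    linarith [hb ζ (by linarith) h him]
  have hcomp : HasDerivAt (fun w => mittagLeffler α (exp w)) 0 ζ := by
    have h1 := (hzexp ▸ (hE z).hasDerivAt).comp ζ (hasDerivAt_exp ζ)
    rw [hzexp, hz, zero_mul] at h1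
    exact h1
  have hder := hcomp.sub (hasDerivAt_mlGrowth α ζ)
  have hest : ‖deriv (fun w => mittagLeffler α (exp w) - mlGrowth α w) ζ‖ ≤ M / δ := by
    refine norm_deriv_le_of_forall_mem_sphere_norm_le hδ0 ?_ fun w hw => hg w ?_ ?_
    · refine Differentiable.diffContOnCl fun w => ?_
      exact ((hE _).comp w differentiableAt_exp).sub (hasDerivAt_mlGrowth α w).differentiableAt
    · have h2 := (abs_re_le_norm (w - ζ)).trans_eq (mem_sphere_iff_norm.1 hw)
      rw [sub_re] at h2
      linarith [(abs_le.1 h2).1, min_le_left 1 (θ₂ - θ₁)]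
    · have h2 := (abs_im_le_norm (w - ζ)).trans_eq (mem_sphere_iff_norm.1 hw)
      rw [sub_im] at h2
      linarith [abs_sub_abs_le_abs_sub w.im ζ.im, min_le_right 1 (θ₂ - θ₁)]
  have hderiv : deriv (fun w => mittagLeffler α (exp w) - mlGrowth α w) ζ = _ := hder.deriv
  rw [hderiv, zero_sub, norm_neg, norm_mul, norm_mul, norm_inv, norm_exp_div,
    Complex.norm_real, Real.norm_of_nonneg hα.le] at hest
  have h1 : 1 ≤ Real.exp (ζ.re / α) := Real.one_le_exp (by positivity)
  have hG : ‖mlGrowth α ζ‖ ≤ α * (M / δ) := by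
    calc ‖mlGrowth α ζ‖ ≤ Real.exp (ζ.re / α) * ‖mlGrowth α ζ‖ :=
          le_mul_of_one_le_left (norm_nonneg _) h1
      _ = α * (α⁻¹ * Real.exp (ζ.re / α) * ‖mlGrowth α ζ‖) := by field_simp
      _ ≤ α * (M / δ) := by gcongr
  have hd := hg ζ (by linarith) (by linarith)
  rw [hzexp] at hd
  linarith [norm_le_norm_sub_add (mittagLeffler α z) (mlGrowth α ζ)]

/-- A path along which `exp` stays in a disc not containing `0` is bounded. -/
lemma exists_norm_le_of_norm_exp_sub_le {v : ℝ → ℂ} {c : ℂ} {r T : ℝ} (hr : r < ‖c‖)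
    (hv : ContinuousOn v (Ici T)) (h : ∀ t ∈ Ici T, ‖exp (v t) - c‖ ≤ r) :
    ∃ B, ∀ t ∈ Ici T, ‖v t‖ ≤ B := by
  have hr0 : 0 ≤ r := (norm_nonneg _).trans (h T self_mem_Ici)
  have hc : 0 < ‖c‖ := hr0.trans_lt hr
  have hc0 : c ≠ 0 := norm_pos_iff.1 hc
  set b := log c with hb
  have hcos : ∀ t ∈ Ici T, 0 < Real.cos ((v t).im - b.im) := fun t ht => by
    have h1 : ‖exp (v t - b) - 1‖ < 1 := by
      rw [exp_sub, hb, exp_log hc0, div_sub_one hc0, norm_div, div_lt_one hc]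
      exact (h t ht).trans_lt hr
    have h2 := (abs_lt.1 ((abs_re_le_norm _).trans_lt h1)).1
    rw [sub_re, one_re, exp_re, sub_im] at h2
    exact pos_of_mul_pos_right (by linarith) (Real.exp_pos _).le
  have him : ∀ t ∈ Ici T, |(v t).im - (v T).im| < Real.pi := by
    intro t ht
    by_contra! hcon
    have hcont : ContinuousOn (fun s => |(v s).im - (v T).im|) (Icc T t) :=
      ((continuous_im.comp_continuousOn (hv.mono Icc_subset_Ici_self)).sub
        continuousOn_const).abs
    obtain ⟨s, hs, hsπ⟩ := intermediate_value_Icc ht hcont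
      (show Real.pi ∈ Icc _ _ from ⟨by simp [Real.pi_pos.le], hcon⟩)
    have h1 := hcos s hs.1
    have h2 := hcos T self_mem_Ici
    rcases (abs_eq Real.pi_pos.le).1 hsπ with h3 | h3
    · rw [show (v s).im - b.im = (v T).im - b.im + Real.pi by linarith, Real.cos_add_pi] at h1
      linarith
    · rw [show (v s).im - b.im = (v T).im - b.im - Real.pi by linarith, Real.cos_sub_pi] at h1
      linarith
  refine ⟨max (Real.log (‖c‖ + r)) (-Real.log (‖c‖ - r)) + (Real.pi + |(v T).im|),
    fun t ht => (norm_le_abs_re_add_abs_im _).trans (add_le_add ?_ ?_)⟩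
  · have h1 := norm_sub_norm_le (exp (v t)) c
    have h2 := norm_sub_norm_le c (exp (v t))
    rw [norm_sub_rev c] at h2
    rw [Complex.norm_exp] at h1 h2
    have h3 := h t ht
    refine abs_le'.2 ⟨le_trans ?_ (le_max_left _ _), le_trans ?_ (le_max_right _ _)⟩
    · rw [Real.le_log_iff_exp_le (by linarith)]; linarith
    · rw [neg_le_neg_iff, Real.log_le_iff_le_exp (by linarith)]; linarith
  · linarith [him t ht, abs_sub_abs_le_abs_sub (v t).im (v T).im]

lemma isBounded_asymptoticValues {α : ℝ} (hα : 0 < α) (hα2 : α < 2) :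
    Bornology.IsBounded (asymptoticValues (mittagLeffler α)) := by
  obtain ⟨θ₁, θ₂, M, hθ, hθπ, hM, hb, hg⟩ := exists_asymptotics hα hα2
  refine isBounded_iff_forall_norm_le.2 ⟨M + 1, ?_⟩
  rintro a ⟨γ, hγ, hγ', ha⟩
  by_contra! hcon
  have hα' : (α : ℂ) ≠ 0 := ofReal_ne_zero.2 hα.ne'
  obtain ⟨T, hT⟩ := eventually_atTop.1 ((hγ'.eventually_ge_atTop (Real.exp 1)).and
    (ha.eventually (Metric.ball_mem_nhds a one_half_pos)))
  have hne : ∀ t ∈ Ici T, γ t ≠ 0 := fun t ht =>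
    norm_pos_iff.1 ((Real.exp_pos 1).trans_le (hT t ht).1)
  have hlog : ∀ t ∈ Ici T, 1 ≤ (log (γ t)).re := fun t ht => by
    rw [log_re, Real.le_log_iff_exp_le (norm_pos_iff.2 (hne t ht))]
    exact (hT t ht).1
  have hEa : ∀ t ∈ Ici T, ‖mittagLeffler α (γ t) - a‖ < 1 / 2 := fun t ht => by
    rw [← dist_eq_norm]
    exact (hT t ht).2
  have harg : ∀ t ∈ Ici T, |(log (γ t)).im| < θ₁ := fun t ht => by
    by_contra! h1
    have h2 := hb _ (hlog t ht) h1 (by rw [log_im]; exact abs_arg_le_pi _)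
    rw [exp_log (hne t ht)] at h2
    have h3 := norm_sub_norm_le a (mittagLeffler α (γ t))
    rw [norm_sub_rev] at h3
    linarith [hEa t ht]
  have hslit : ∀ t ∈ Ici T, γ t ∈ slitPlane := fun t ht => by
    refine mem_slitPlane_iff_arg.2 ⟨fun h => ?_, hne t ht⟩
    have := harg t ht
    rw [log_im, h, abs_of_pos Real.pi_pos] at this
    linarith
  obtain ⟨B, hB⟩ := exists_norm_le_of_norm_exp_sub_le (v := fun t => exp (log (γ t) / α))
    (c := α * a) (r := α * (M + 1 / 2)) (T := T)
    (by rw [norm_mul, Complex.norm_real, Real.norm_of_nonneg hα.le]; gcongr; linarith)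
    ((hγ.continuousOn.clog hslit).div_const _).cexp fun t ht => by
      have h1 := hg _ (hlog t ht) ((harg t ht).trans hθ).le
      rw [exp_log (hne t ht)] at h1
      have h2 : exp (exp (log (γ t) / α)) - α * a = α * (mlGrowth α (log (γ t)) - a) := by
        rw [mlGrowth]; field_simp
      rw [h2, norm_mul, Complex.norm_real, Real.norm_of_nonneg hα.le]
      gcongr
      have h3 := norm_sub_le_norm_sub_add_norm_sub (mlGrowth α (log (γ t)))
        (mittagLeffler α (γ t)) a
      rw [norm_sub_rev] at h1
      linarith [hEa t ht]
  have hlim : Tendsto (fun t => Real.exp (Real.log ‖γ t‖ / α)) atTop atTop :=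
    Real.tendsto_exp_atTop.comp ((Real.tendsto_log_atTop.comp hγ').atTop_div_const hα)
  obtain ⟨t, ht, htT⟩ := ((hlim.eventually_gt_atTop B).and (eventually_ge_atTop T)).exists
  have := hB t htT
  simp only [norm_exp_div, log_re] at this
  linarith

end MittagLeffler

/-- The Mittag-Leffler function belongs to the Eremenko–Lyubich class `B`:
its set of critical values and finite asymptotic values is bounded. -/
theorem mittagLeffler_in_classB (α : ℝ) (hα : α ∈ Set.Ioo (0 : ℝ) 2) :
    Bornology.IsBounded
      (criticalValues (mittagLeffler α) ∪ asymptoticValues (mittagLeffler α)) := by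
  exact (MittagLeffler.isBounded_criticalValues hα.1 hα.2).union
    (MittagLeffler.isBounded_asymptoticValues hα.1 hα.2)
end
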